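/- The diagram relating the Aomoto trilogarithm and the classical trilogarithm commutes on generators: for every admissible pair of tetrahedra (l_0,...,l_3;m_0,...,m_3) in generic position in P³(F), one has δ_3( a_3(l_0,...,l_3;m_0,...,m_3) ) = (a_2 ∧ a_1)( ν_{2,1}(l_0,...,l_3;m_0,...,m_3) + ν_{1,2}(l_0,...,l_3;m_0,...,m_3) ) in (B_2(F) ⊗ F*) ⊗ ℚ, where a_3 := (1/6)a_3' − (1/3)a_3'' and (a_2 ∧ a_1)(x_2 ⊗ x_1 + y_1 ⊗ y_2) := a_2(x_2) ⊗ a_1(x_1) − a_2(y_2) ⊗ a_1(y_1). -/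

import Mathlib

noncomputable section
open scoped TensorProduct
open Classical

namespace Gon

variable (F : Type) [Field F]

/-- Points of the projective space `P^{d-1}(F)`, i.e. lines in `F^d`. -/
abbrev Pt (d : ℕ) := Projectivization F (Fin d → F)

variable {F}

/-- Determinant of a `d`-tuple of vectors in `F^d` (w.r.t. the standard volume form). -/
def dt {d : ℕ} (v : Fin d → (Fin d → F)) : F := Matrix.det (Matrix.of v)

/-- `Δ` of three vectors of `F^3`. -/
def det3 (a b c : Fin 3 → F) : F := dt ![a, b, c]

/-- `Δ` of four vectors of `F^4`. -/
def det4 (a b c d : Fin 4 → F) : F := dt ![a, b, c, d]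

/-- Cross-ratio of four points on the projective line. -/
def cr1 (a b c d : Pt F 2) : F :=
  (dt ![a.rep, c.rep] * dt ![b.rep, d.rep]) / (dt ![a.rep, d.rep] * dt ![b.rep, c.rep])

/-- Cross-ratio of the four points of `P^1` obtained by projecting `a b c d` from the
centre `e` in the projective plane. -/
def crFrom3 (e a b c d : Pt F 3) : F :=
  (det3 e.rep a.rep c.rep * det3 e.rep b.rep d.rep) /
    (det3 e.rep a.rep d.rep * det3 e.rep b.rep c.rep)

/-- Cross-ratio of the four points of `P^1` obtained by projecting `a b c d` from the
line through `p` and `q` in `P^3`. -/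
def crLine (p q a b c d : Pt F 4) : F :=
  (det4 p.rep q.rep a.rep c.rep * det4 p.rep q.rep b.rep d.rep) /
    (det4 p.rep q.rep a.rep d.rep * det4 p.rep q.rep b.rep c.rep)

variable (F)

/-- `ℚ[F]`, the free `ℚ`-vector space on the set `F`. -/
abbrev QF := F →₀ ℚ

variable {F}

/-- The generator `{x}` of `ℚ[F]`, with the convention `{0} = {∞} = 0`. -/
def gen (a : F) : QF F := if a = 0 then 0 else Finsupp.single a 1

/-- `sign(I, Ī)`: the sign of the shuffle permutation `(1,...,n) → (I, Ī)`, for a subset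
`I ⊆ {1,...,n}` of `{0,1,...,n}`; it equals `(-1)^(Σ_{i∈I} i - |I|(|I|+1)/2)`. -/
def shufSign {N : ℕ} (I : Finset (Fin N)) : ℤ :=
  (-1) ^ (∑ i ∈ I, (i : ℕ) - I.card * (I.card + 1) / 2)

/-- The tuple of the elements of `S`, listed in increasing order (junk if `c ≠ |S|`). -/
def tupleOf {N : ℕ} {X : Type} (S : Finset (Fin (N + 1))) (x : Fin (N + 1) → X) {c : ℕ} :
    Fin c → X :=
  fun t => x ((S.sort (· ≤ ·)).getD (t : ℕ) 0)

/-- The five term element of `ℚ[F]` attached to five points of the projective line. -/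
def fiveTerm (x : Fin 5 → Pt F 2) : QF F :=
  ∑ i : Fin 5, ((-1 : ℤ) ^ (i : ℕ)) •
    gen (cr1 (x (i.succAbove 0)) (x (i.succAbove 1)) (x (i.succAbove 2)) (x (i.succAbove 3)))

variable (F)

/-- `R_2(F)`: the five-term relations for five distinct points of `P^1(F)`, together with
`{1}` (the generators of `ℤ[F^* ∖ {1}]` omit `1`). -/
def R2 : Submodule ℚ (QF F) :=
  Submodule.span ℚ
    ({z | ∃ x : Fin 5 → Pt F 2, Function.Injective x ∧ z = fiveTerm x} ∪ {gen (1 : F)})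

/-- The Bloch group `B_2(F)` (tensored with `ℚ`). -/
abbrev B2 := QF F ⧸ R2 F

def clsB2 : QF F →ₗ[ℚ] B2 F := (R2 F).mkQ

/-- `{x}_2 ∈ B_2(F)`. -/
def b2 (a : F) : B2 F := clsB2 F (gen a)

variable {F}

variable (F)

/-- triple ratio of six points of the plane. -/
def tripleRatio (x : Fin 6 → Pt F 3) : F :=
  (det3 (x 0).rep (x 1).rep (x 3).rep * det3 (x 1).rep (x 2).rep (x 4).rep *
      det3 (x 2).rep (x 0).rep (x 5).rep) /
    (det3 (x 0).rep (x 1).rep (x 4).rep * det3 (x 1).rep (x 2).rep (x 5).rep *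
      det3 (x 2).rep (x 0).rep (x 3).rep)

variable {F}

/-- The generalized cross-ratio `r_3` of six points of `P^2` in generic position:
`r_3(x_1,...,x_6) = (1/15)·Alt_6 {triple ratio}`, as an element of `ℚ[F]`. -/
def r3free (x : Fin 6 → Pt F 3) : QF F :=
  (1 / 15 : ℚ) • ∑ σ : Equiv.Perm (Fin 6), (Equiv.Perm.sign σ : ℤ) • gen (tripleRatio F (x ∘ σ))

/-- Six points of `P^2` are in generic position: no two coincide, no three collinear. -/
def Generic6 (x : Fin 6 → Pt F 3) : Prop :=
  ∀ a b c : Fin 6, a ≠ b → a ≠ c → b ≠ c → det3 (x a).rep (x b).rep (x c).rep ≠ 0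

/-- Kummer's functional equation for the trilogarithm. -/
def kummer (x y : F) : QF F :=
  -gen (x * (1 - y) ^ 2 / (y * (1 - x) ^ 2)) - gen (x * y) - gen (x / y) - (2 : ℚ) • gen 1 +
    (2 : ℚ) • (gen (-x * (1 - y) / (1 - x)) + gen (x * (1 - y) / (y * (1 - x))) +
      gen (-y * (1 - x) / (1 - y)) + gen ((1 - x) / (1 - y)) + gen y + gen x)

variable (F)

/-- `R_3(F)`: generated by `{x} - {x⁻¹}`, the seven term relations for seven generic
points of the plane, and Kummer's relations. -/
def R3 : Submodule ℚ (QF F) :=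
  Submodule.span ℚ
    ({z | ∃ x : F, z = gen x - gen x⁻¹} ∪
      {z | ∃ x : Fin 7 → Pt F 3, (∀ i j k : Fin 7, i ≠ j → i ≠ k → j ≠ k →
          det3 (x i).rep (x j).rep (x k).rep ≠ 0) ∧
          z = ∑ i : Fin 7, ((-1 : ℤ) ^ (i : ℕ)) • r3free (x ∘ i.succAbove)} ∪
      {z | ∃ x y : F, x ≠ 0 ∧ x ≠ 1 ∧ y ≠ 0 ∧ y ≠ 1 ∧ z = kummer x y})

/-- `B_3(F)` (tensored with `ℚ`). -/
abbrev B3 := QF F ⧸ R3 F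

def clsB3 : QF F →ₗ[ℚ] B3 F := (R3 F).mkQ

/-- `{x}_3 ∈ B_3(F)`. -/
def b3 (a : F) : B3 F := clsB3 F (gen a)

variable {F}

/-- `μ_3`, relative to a given cross-ratio function `cr` (18 terms, with the factor 1/4):
`μ_3(x_1,x_2,x_3;y_1,y_2,y_3) = (1/4)·Alt_{(x)(y)}({r(x_1,y_2,x_2,y_1)} - {r(x_1,y_1,x_2,y_2)})`. -/
def mu3 {P : Type} (cr : P → P → P → P → F) (x y : Fin 3 → P) : QF F :=
  (1 / 4 : ℚ) • ∑ σ : Equiv.Perm (Fin 3), ∑ τ : Equiv.Perm (Fin 3),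
    (((Equiv.Perm.sign σ : ℤ) * (Equiv.Perm.sign τ : ℤ)) : ℤ) •
      (gen (cr (x (σ 0)) (y (τ 1)) (x (σ 1)) (y (τ 0))) -
        gen (cr (x (σ 0)) (y (τ 0)) (x (σ 1)) (y (τ 1))))

variable (F)

/-- `F^* ⊗ ℚ`, presented as the free `ℚ`-vector space on `F` modulo multiplicativity
(and modulo the generator at `0`). -/
def FSrel : Set (QF F) :=
  {z | ∃ x y : F, x ≠ 0 ∧ y ≠ 0 ∧
      z = Finsupp.single (x * y) 1 - Finsupp.single x 1 - Finsupp.single y 1} ∪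
    {Finsupp.single (0 : F) 1}

abbrev FS := QF F ⧸ Submodule.span ℚ (FSrel F)

/-- The class of `x ∈ F` in `F^* ⊗ ℚ`. -/
def fs (a : F) : FS F := (Submodule.span ℚ (FSrel F)).mkQ (Finsupp.single a 1)

variable {F}

/-- triple ratio of the configuration of six points of `P^2` obtained by projecting the
six points `z` of `P^3` from the centre `e`. -/
def tripleRatioFrom4 (e : Pt F 4) (z : Fin 6 → Pt F 4) : F :=
  (det4 e.rep (z 0).rep (z 1).rep (z 3).rep * det4 e.rep (z 1).rep (z 2).rep (z 4).rep *
      det4 e.rep (z 2).rep (z 0).rep (z 5).rep) /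
    (det4 e.rep (z 0).rep (z 1).rep (z 4).rep * det4 e.rep (z 1).rep (z 2).rep (z 5).rep *
      det4 e.rep (z 2).rep (z 0).rep (z 3).rep)

/-- `r_3` of the configuration of six points of `P^2` obtained by projection from `e ∈ P^3`. -/
def r3From4 (e : Pt F 4) (z : Fin 6 → Pt F 4) : QF F :=
  (1 / 15 : ℚ) • ∑ σ : Equiv.Perm (Fin 6), (Equiv.Perm.sign σ : ℤ) •
    gen (tripleRatioFrom4 e (z ∘ σ))

/-- `a_3'(l_0,...,l_3;m_0,...,m_3) = Σ_{i,j} (-1)^{i+j} r_3(l_i | l̂_i; m̂_j)`. -/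
def a3p (l m : Fin 4 → Pt F 4) : QF F :=
  ∑ i : Fin 4, ∑ j : Fin 4, ((-1 : ℤ) ^ ((i : ℕ) + (j : ℕ))) •
    r3From4 (l i) ![l (i.succAbove 0), l (i.succAbove 1), l (i.succAbove 2),
      m (j.succAbove 0), m (j.succAbove 1), m (j.succAbove 2)]

/-- `a_3''(l_0,...,l_3;m_0,...,m_3) = Σ_{i,j} (-1)^{i+j} μ_3(l_i,m_j | l̂_i; m̂_j)`,
the cross-ratios being taken after projection from the line through `l_i` and `m_j`. -/
def a3pp (l m : Fin 4 → Pt F 4) : QF F :=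
  ∑ i : Fin 4, ∑ j : Fin 4, ((-1 : ℤ) ^ ((i : ℕ) + (j : ℕ))) •
    mu3 (crLine (l i) (m j)) (l ∘ i.succAbove) (m ∘ j.succAbove)

/-- `a_3 = (1/6)·a_3' - (1/3)·a_3''` (at the level of `ℚ[F]`). -/
def a3free (l m : Fin 4 → Pt F 4) : QF F :=
  (1 / 6 : ℚ) • a3p l m - (1 / 3 : ℚ) • a3pp l m

/-- A pair of tetrahedra in `P^3` is in generic position when any four of the eight
vertices are projectively independent. -/
def GenericPair (l m : Fin 4 → Pt F 4) : Prop :=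
  ∀ a b c d : Fin 8, a ≠ b → a ≠ c → a ≠ d → b ≠ c → b ≠ d → c ≠ d →
    det4 ((Fin.append l m a).rep) ((Fin.append l m b).rep)
      ((Fin.append l m c).rep) ((Fin.append l m d).rep) ≠ 0

/-- `a_2` of the configuration of `3+3` points of `P^2` obtained by projecting the points
`x; y` of `P^3` from the centre `e`:
`Σ_{i,j} (-1)^{i+j} {r(x_i | x̂_i; ŷ_j)}` (cross-ratios after projection from `e, x_i`). -/
def a2From4 (e : Pt F 4) (x y : Fin 3 → Pt F 4) : QF F :=
  ∑ i : Fin 3, ∑ j : Fin 3, ((-1 : ℤ) ^ ((i : ℕ) + (j : ℕ))) •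
    gen (crLine e (x i) (x (i.succAbove 0)) (x (i.succAbove 1))
      (y (j.succAbove 0)) (y (j.succAbove 1)))

variable (F)

/-- `(B_2(F) ⊗ F^*) ⊗ ℚ`. -/
abbrev T21 := B2 F ⊗[ℚ] FS F

/-- The map `δ_3 : ℚ[F] → B_2(F) ⊗ F^*` induced by `{x}_3 ↦ {x}_2 ⊗ x`. -/
def Dmap : QF F →ₗ[ℚ] T21 F :=
  Finsupp.lift (T21 F) ℚ F (fun a => b2 F a ⊗ₜ fs F a)

variable {F}

lemma b2_zero : b2 F 0 = 0 := by simp [b2, gen]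

lemma b2_one : b2 F 1 = 0 := by
  simp only [b2, clsB2, Submodule.mkQ_apply, Submodule.Quotient.mk_eq_zero]
  exact Submodule.subset_span (Or.inr rfl)

/-- The cross-ratio of points of the projective line, computed on arbitrary lifts. -/
lemma cr1_mk (a b c d : Fin 2 → F) (ha : a ≠ 0) (hb : b ≠ 0) (hc : c ≠ 0) (hd : d ≠ 0) :
    cr1 (Projectivization.mk F a ha) (Projectivization.mk F b hb) (Projectivization.mk F c hc)
      (Projectivization.mk F d hd) =
      ((a 0 * c 1 - a 1 * c 0) * (b 0 * d 1 - b 1 * d 0)) /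
        ((a 0 * d 1 - a 1 * d 0) * (b 0 * c 1 - b 1 * c 0)) := by
  obtain ⟨ua, hua⟩ := Projectivization.exists_smul_eq_mk_rep F a ha
  obtain ⟨ub, hub⟩ := Projectivization.exists_smul_eq_mk_rep F b hb
  obtain ⟨uc, huc⟩ := Projectivization.exists_smul_eq_mk_rep F c hc
  obtain ⟨ud, hud⟩ := Projectivization.exists_smul_eq_mk_rep F d hd
  have h : (ua : F) * ub * uc * ud ≠ 0 := by simp
  simp only [cr1, dt, ← hua, ← hub, ← huc, ← hud, Matrix.det_fin_two, Matrix.of_apply,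
    Matrix.cons_val_zero, Matrix.cons_val_one, Pi.smul_apply, Units.smul_def, smul_eq_mul]
  rw [eq_comm, ← mul_div_mul_left _ _ h]
  congr 1 <;> ring

/-- The five-term relation in terms of two parameters. -/
lemma b2_five {x y : F} (hx0 : x ≠ 0) (hx1 : x ≠ 1) (hy0 : y ≠ 0) (hy1 : y ≠ 1) :
    b2 F x - b2 F y + b2 F (y / x) - b2 F ((1 - y) / (1 - x)) +
      b2 F (x * (1 - y) / (y * (1 - x))) = 0 := by
  have hx1' : 1 - x ≠ 0 := sub_ne_zero.2 hx1.symm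
  have hy1' : 1 - y ≠ 0 := sub_ne_zero.2 hy1.symm
  rcases eq_or_ne x y with rfl | hxy
  · rw [div_self hx0, div_self hx1', div_self (mul_ne_zero hx0 hx1'), b2_one]
    simp
  let v : Fin 5 → Fin 2 → F := ![![1, 0], ![0, 1], ![1, 1], ![x, 1], ![y, 1]]
  have hv : ∀ i, v i ≠ 0 := by
    intro i hi
    have h0 := congrFun hi 0
    have h1 := congrFun hi 1
    fin_cases i <;> simp [v] at h0 h1
  let p : Fin 5 → Pt F 2 := fun i => Projectivization.mk F (v i) (hv i)
  have hp : Function.Injective p := by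
    intro i j hij
    obtain ⟨u, hu⟩ := (Projectivization.mk_eq_mk_iff F _ _ (hv i) (hv j)).1 hij
    have h0 := congrFun hu 0
    have h1 := congrFun hu 1
    simp only [Pi.smul_apply, Units.smul_def, smul_eq_mul] at h0 h1
    have hu0 : (u : F) ≠ 0 := u.ne_zero
    fin_cases i <;> fin_cases j <;> simp [v, hu0] at h0 h1 ⊢ <;> simp_all
  have hmem : fiveTerm p ∈ R2 F := Submodule.subset_span (Or.inl ⟨p, hp, rfl⟩)
  have h : clsB2 F (fiveTerm p) = 0 := by
    simpa [clsB2, Submodule.Quotient.mk_eq_zero] using hmem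
  simp only [fiveTerm, Fin.sum_univ_five, map_add, map_zsmul] at h
  simp only [p, cr1_mk, Fin.succAbove, v] at h
  simp [Fin.lt_def] at h
  rw [← h]
  simp only [b2]
  abel

lemma b2_add_inv_mul {u v : F} (hu0 : u ≠ 0) (hu1 : u ≠ 1) (hv0 : v ≠ 0) (hv1 : v ≠ 1)
    (huv : u ≠ v) :
    b2 F v + b2 F v⁻¹ = b2 F u + b2 F u⁻¹ + (b2 F (v / u) + b2 F (v / u)⁻¹) := by
  have h1 : v - u ≠ 0 := sub_ne_zero.2 huv.symm
  have h2 : v - 1 ≠ 0 := sub_ne_zero.2 hv1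
  have h3 : u - 1 ≠ 0 := sub_ne_zero.2 hu1
  have hx0 : (v - 1) / (v - u) ≠ 0 := div_ne_zero h2 h1
  have hx : 1 - (v - 1) / (v - u) = -(u - 1) / (v - u) := by field_simp; ring
  have hy : 1 - u * ((v - 1) / (v - u)) = -(u - 1) * v / (v - u) := by field_simp; ring
  have hx' : -(u - 1) / (v - u) ≠ 0 := div_ne_zero (neg_ne_zero.2 h3) h1
  have hy' : -(u - 1) * v / (v - u) ≠ 0 := div_ne_zero (mul_ne_zero (neg_ne_zero.2 h3) hv0) h1
  have hx1 : (v - 1) / (v - u) ≠ 1 := fun h => hx' (by rw [← hx, h, sub_self])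
  have hy1 : u * ((v - 1) / (v - u)) ≠ 1 := fun h => hy' (by rw [← hy, h, sub_self])
  have hy0 := mul_ne_zero hu0 hx0
  have e1 := b2_five hx0 hx1 hy0 hy1
  have e2 := b2_five hy0 hy1 hx0 hx1
  rw [hx, hy] at e1 e2
  have r1 : u * ((v - 1) / (v - u)) / ((v - 1) / (v - u)) = u := by field_simp
  have r1' : (v - 1) / (v - u) / (u * ((v - 1) / (v - u))) = u⁻¹ := by field_simp
  have r2 : -(u - 1) * v / (v - u) / (-(u - 1) / (v - u)) = v := by field_simp
  have r2' : -(u - 1) / (v - u) / (-(u - 1) * v / (v - u)) = v⁻¹ := by field_simp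
  have r3 : (v - 1) / (v - u) * (-(u - 1) * v / (v - u)) /
      (u * ((v - 1) / (v - u)) * (-(u - 1) / (v - u))) = v / u := by field_simp
  have r3' : u * ((v - 1) / (v - u)) * (-(u - 1) / (v - u)) /
      ((v - 1) / (v - u) * (-(u - 1) * v / (v - u))) = (v / u)⁻¹ := by field_simp
  rw [r1, r2, r3] at e1
  rw [r1', r2', r3'] at e2
  rw [← sub_eq_zero, ← neg_eq_zero]
  calc _ = _ := ?_
    _ = 0 := congrArg₂ (· + ·) e1 e2 |>.trans (add_zero 0)
  abel

lemma b2_inv [Infinite F] (x : F) : b2 F x⁻¹ = -b2 F x := by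
  rcases eq_or_ne x 0 with rfl | hx0
  · simp [b2_zero]
  rcases eq_or_ne x 1 with rfl | hx1
  · simp [b2_one]
  obtain ⟨u, hu⟩ := Infinite.exists_notMem_finset ({0, 1, x⁻¹} : Finset F)
  simp only [Finset.mem_insert, Finset.mem_singleton, not_or] at hu
  obtain ⟨hu0, hu1, hux⟩ := hu
  have hxu0 : x * u ≠ 0 := mul_ne_zero hx0 hu0
  have hxu1 : x * u ≠ 1 := fun h => hux (eq_inv_of_mul_eq_one_right h)
  have hne : u ≠ x * u := fun h => hx1 (mul_right_cancel₀ hu0 (by rw [one_mul, ← h]))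
  have e1 := b2_add_inv_mul hu0 hu1 hxu0 hxu1 hne
  have e2 := b2_add_inv_mul hxu0 hxu1 hu0 hu1 hne.symm
  have r1 : x * u / u = x := by field_simp
  have r2 : u / (x * u) = x⁻¹ := by field_simp
  rw [r1] at e1
  rw [r2, inv_inv] at e2
  have h2 : (2 : ℚ) • (b2 F x⁻¹ + b2 F x) = 0 := by
    rw [e1] at e2
    rw [two_smul]
    have := sub_eq_zero.2 e2
    rw [← neg_eq_zero, ← this]
    abel
  exact eq_neg_of_add_eq_zero_left ((smul_eq_zero.1 h2).resolve_left two_ne_zero)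

lemma b2_one_sub [Infinite F] (x : F) : b2 F (1 - x) = -b2 F x := by
  rcases eq_or_ne x 0 with rfl | hx0
  · simp [b2_zero, b2_one]
  rcases eq_or_ne x 1 with rfl | hx1
  · simp [b2_zero, b2_one]
  have const : ∀ y : F, y ≠ 0 → y ≠ 1 → b2 F x + b2 F (1 - x) = b2 F y + b2 F (1 - y) := by
    intro y hy0 hy1
    have e1 := b2_five hx0 hx1 hy0 hy1
    have e2 := b2_five (sub_ne_zero.2 hx1.symm) (by simpa using hx0) (sub_ne_zero.2 hy1.symm)
      (by simpa using hy0)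
    rw [sub_sub_cancel, sub_sub_cancel, mul_comm (1 - x) y, mul_comm (1 - y) x,
      ← inv_div (x * (1 - y)), b2_inv] at e2
    rw [← sub_eq_zero]
    calc _ = _ := ?_
      _ = 0 := congrArg₂ (· + ·) e1 e2 |>.trans (add_zero 0)
    abel
  have hx1' : 1 - x ≠ 0 := sub_ne_zero.2 hx1.symm
  have e1 := const x⁻¹ (inv_ne_zero hx0) (by simpa using hx1)
  have e2 := const (1 - x)⁻¹ (inv_ne_zero hx1') (by simpa using hx0)
  have r : 1 - (1 - x)⁻¹ = (1 - x⁻¹)⁻¹ := by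
    have : x - 1 ≠ 0 := sub_ne_zero.2 hx1
    have h3 : 1 - x⁻¹ = (x - 1) / x := by field_simp
    rw [h3, inv_div, show x - 1 = -(1 - x) by ring]
    field_simp
    ring
  rw [r, b2_inv, b2_inv] at e2
  rw [b2_inv] at e1
  have h3 : (3 : ℚ) • (b2 F (1 - x) + b2 F x) = 0 := by
    have : (3 : ℚ) • (b2 F (1 - x) + b2 F x) = (b2 F x + b2 F (1 - x)) +
      (b2 F x + b2 F (1 - x)) + (b2 F x + b2 F (1 - x)) := by module
    rw [this]
    nth_rewrite 1 [e1]
    nth_rewrite 1 [e2]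
    abel
  exact eq_neg_of_add_eq_zero_left ((smul_eq_zero.1 h3).resolve_left three_ne_zero)

lemma fs_mul {x y : F} (hx : x ≠ 0) (hy : y ≠ 0) : fs F (x * y) = fs F x + fs F y := by
  have h : (Submodule.span ℚ (FSrel F)).mkQ
      (Finsupp.single (x * y) 1 - Finsupp.single x 1 - Finsupp.single y 1) = 0 := by
    rw [Submodule.mkQ_apply, Submodule.Quotient.mk_eq_zero]
    exact Submodule.subset_span (Or.inl ⟨x, y, hx, hy, rfl⟩)
  rw [map_sub, map_sub, sub_sub, sub_eq_zero] at h
  exact h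

lemma fs_zero : fs F 0 = 0 := by
  rw [fs, Submodule.mkQ_apply, Submodule.Quotient.mk_eq_zero]
  exact Submodule.subset_span (Or.inr rfl)

lemma fs_one : fs F 1 = 0 := by
  simpa using fs_mul (one_ne_zero (α := F)) one_ne_zero

lemma fs_inv (x : F) : fs F x⁻¹ = -fs F x := by
  rcases eq_or_ne x 0 with rfl | hx
  · simp [fs_zero]
  · rw [eq_neg_iff_add_eq_zero, ← fs_mul (inv_ne_zero hx) hx, inv_mul_cancel₀ hx, fs_one]

lemma fs_div {x y : F} (hx : x ≠ 0) (hy : y ≠ 0) : fs F (x / y) = fs F x - fs F y := by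
  rw [div_eq_mul_inv, fs_mul hx (inv_ne_zero hy), fs_inv, sub_eq_add_neg]

lemma fs_neg (x : F) : fs F (-x) = fs F x := by
  rcases eq_or_ne x 0 with rfl | hx
  · simp
  have h1 : (2 : ℚ) • fs F (-1) = 0 := by
    rw [two_smul, ← fs_mul (by simp) (by simp)]
    simp [fs_one]
  rw [← neg_one_mul, fs_mul (by simp) hx, (smul_eq_zero.1 h1).resolve_left two_ne_zero, zero_add]

lemma fs_eq_zero_of_finite [Finite F] (x : F) : fs F x = 0 := by
  rcases eq_or_ne x 0 with rfl | hx
  · exact fs_zero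
  have hpow : ∀ n : ℕ, fs F (x ^ n) = (n : ℚ) • fs F x := by
    intro n
    induction n with
    | zero => simp [fs_one]
    | succ n ih => rw [pow_succ, fs_mul (pow_ne_zero n hx) hx, ih]; push_cast; module
  have hfin : IsOfFinOrder (Units.mk0 x hx) := isOfFinOrder_of_finite _
  obtain ⟨n, hn, h1⟩ := hfin.exists_pow_eq_one
  have h2 : x ^ n = 1 := by simpa using congrArg Units.val h1
  have h3 := hpow n
  rw [h2, fs_one] at h3
  exact (smul_eq_zero.1 h3.symm).resolve_left (by exact_mod_cast hn.ne')

/-- The determinant of the chosen lifts of four points of `P³`. -/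
def br (a b c d : Pt F 4) : F := det4 a.rep b.rep c.rep d.rep

lemma det4_eq (a b c d : Fin 4 → F) : det4 a b c d =
    (a 0 * b 1 - a 1 * b 0) * (c 2 * d 3 - c 3 * d 2)
    - (a 0 * b 2 - a 2 * b 0) * (c 1 * d 3 - c 3 * d 1)
    + (a 0 * b 3 - a 3 * b 0) * (c 1 * d 2 - c 2 * d 1)
    + (a 1 * b 2 - a 2 * b 1) * (c 0 * d 3 - c 3 * d 0)
    - (a 1 * b 3 - a 3 * b 1) * (c 0 * d 2 - c 2 * d 0)
    + (a 2 * b 3 - a 3 * b 2) * (c 0 * d 1 - c 1 * d 0) := by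
  simp [det4, dt, Matrix.det_succ_row_zero, Fin.sum_univ_succ, Fin.succAbove]
  ring

lemma br_swap01 (a b c d : Pt F 4) : br b a c d = -br a b c d := by
  simp only [br, det4_eq]; ring

lemma br_swap12 (a b c d : Pt F 4) : br a c b d = -br a b c d := by
  simp only [br, det4_eq]; ring

lemma br_swap23 (a b c d : Pt F 4) : br a b d c = -br a b c d := by
  simp only [br, det4_eq]; ring

lemma br_pluecker (p q a b c d : Pt F 4) :
    br p q a b * br p q c d - br p q a c * br p q b d + br p q a d * br p q b c = 0 := by
  simp only [br, det4_eq]; ring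

/-- The class in `B_2(F)` of the cross-ratio of `a b c d` seen from the line `p q`. -/
def crB (p q a b c d : Pt F 4) : B2 F := b2 F (crLine p q a b c d)

lemma crLine_eq (p q a b c d : Pt F 4) :
    crLine p q a b c d = br p q a c * br p q b d / (br p q a d * br p q b c) := rfl

lemma crB_comm (p q a b c d : Pt F 4) : crB q p a b c d = crB p q a b c d := by
  simp only [crB, crLine_eq, br_swap01 p q, neg_mul_neg]

lemma crB_swap23 [Infinite F] (p q a b c d : Pt F 4) : crB p q a b d c = -crB p q a b c d := by
  rw [crB, crB, ← b2_inv]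
  simp only [crLine_eq, inv_div]

lemma crB_swap01 [Infinite F] (p q a b c d : Pt F 4) : crB p q b a c d = -crB p q a b c d := by
  rw [crB, crB, ← b2_inv]
  simp only [crLine_eq, inv_div]
  rw [mul_comm (br p q b c), mul_comm (br p q b d)]

lemma crB_swap12 [Infinite F] (p q a b c d : Pt F 4) (had : br p q a d ≠ 0)
    (hbc : br p q b c ≠ 0) : crB p q a c b d = -crB p q a b c d := by
  rw [crB, crB, ← b2_one_sub]
  congr 1
  have h := br_pluecker p q a b c d
  simp only [crLine_eq, br_swap23 p q b c]
  field_simp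
  linear_combination -h

/-- The five-term relation for the entries of a skew-symmetric matrix satisfying the Plücker
relations. -/
lemma b2_five_pluecker {ab ac ad ae bc bd be cd ce : F} (hab : ab ≠ 0) (hac : ac ≠ 0)
    (had : ad ≠ 0) (hae : ae ≠ 0) (hbc : bc ≠ 0) (hbd : bd ≠ 0) (hbe : be ≠ 0) (hcd : cd ≠ 0)
    (hce : ce ≠ 0) (h1 : ab * cd - ac * bd + ad * bc = 0) (h2 : ab * ce - ac * be + ae * bc = 0) :
    b2 F (ac * bd / (ad * bc)) - b2 F (ac * be / (ae * bc)) + b2 F (ad * be / (ae * bd)) -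
      b2 F (ad * ce / (ae * cd)) + b2 F (bd * ce / (be * cd)) = 0 := by
  have e1 : 1 - ac * bd / (ad * bc) = -(ab * cd) / (ad * bc) := by
    field_simp; linear_combination h1
  have e2 : 1 - ac * be / (ae * bc) = -(ab * ce) / (ae * bc) := by
    field_simp; linear_combination h2
  have n1 : -(ab * cd) / (ad * bc) ≠ 0 := by simp [hab, hcd, had, hbc]
  have n2 : -(ab * ce) / (ae * bc) ≠ 0 := by simp [hab, hce, hae, hbc]
  have h := b2_five (x := ac * bd / (ad * bc)) (y := ac * be / (ae * bc))
    (by simp [hac, hbd, had, hbc]) (fun h => n1 (by rw [← e1, h, sub_self]))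
    (by simp [hac, hbe, hae, hbc]) (fun h => n2 (by rw [← e2, h, sub_self]))
  have r1 : ac * be / (ae * bc) / (ac * bd / (ad * bc)) = ad * be / (ae * bd) := by field_simp
  have r2 : -(ab * ce) / (ae * bc) / (-(ab * cd) / (ad * bc)) = ad * ce / (ae * cd) := by
    field_simp
  have r3 : ac * bd / (ad * bc) * (-(ab * ce) / (ae * bc)) /
      (ac * be / (ae * bc) * (-(ab * cd) / (ad * bc))) = bd * ce / (be * cd) := by field_simp
  rwa [e1, e2, r1, r2, r3] at h

/-- No two of the points `z` span, together with the line `p q`, less than the whole space. -/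
def LineGeneric {n : ℕ} (p q : Pt F 4) (z : Fin n → Pt F 4) : Prop :=
  ∀ a b, a ≠ b → br p q (z a) (z b) ≠ 0

/-- The projections of the points `z` from `e` to the plane are in general position. -/
def PlaneGeneric {n : ℕ} (e : Pt F 4) (z : Fin n → Pt F 4) : Prop :=
  ∀ a b c, a ≠ b → a ≠ c → b ≠ c → br e (z a) (z b) (z c) ≠ 0

lemma PlaneGeneric.comp {n k : ℕ} {e : Pt F 4} {z : Fin n → Pt F 4} (h : PlaneGeneric e z)
    {f : Fin k → Fin n} (hf : Function.Injective f) : PlaneGeneric e (z ∘ f) :=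
  fun _ _ _ hab hac hbc => h _ _ _ (hf.ne hab) (hf.ne hac) (hf.ne hbc)

lemma crB_five {p q : Pt F 4} {z : Fin 5 → Pt F 4} (h : LineGeneric p q z) :
    crB p q (z 1) (z 2) (z 3) (z 4) - crB p q (z 0) (z 2) (z 3) (z 4) +
      crB p q (z 0) (z 1) (z 3) (z 4) - crB p q (z 0) (z 1) (z 2) (z 4) +
      crB p q (z 0) (z 1) (z 2) (z 3) = 0 := by
  have key := b2_five_pluecker (h 0 1 (by decide)) (h 0 2 (by decide)) (h 0 3 (by decide))
    (h 0 4 (by decide)) (h 1 2 (by decide)) (h 1 3 (by decide)) (h 1 4 (by decide))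
    (h 2 3 (by decide)) (h 2 4 (by decide)) (br_pluecker ..) (br_pluecker ..)
  rw [← key]
  simp only [crB, crLine_eq]
  abel

/-- The five-term relation for the five projections of five points of the plane. -/
lemma crB_five_centers {e : Pt F 4} {z : Fin 5 → Pt F 4} (h : PlaneGeneric e z) :
    crB e (z 0) (z 1) (z 2) (z 3) (z 4) - crB e (z 1) (z 0) (z 2) (z 3) (z 4) +
      crB e (z 2) (z 0) (z 1) (z 3) (z 4) - crB e (z 3) (z 0) (z 1) (z 2) (z 4) +
      crB e (z 4) (z 0) (z 1) (z 2) (z 3) = 0 := by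
  have hz (a b c : Fin 5) (hab : a ≠ b := by decide) (hac : a ≠ c := by decide)
    (hbc : b ≠ c := by decide) := h a b c hab hac hbc
  have key := b2_five_pluecker (ab := br e (z 2) (z 3) (z 4)) (ac := -br e (z 1) (z 3) (z 4))
    (ad := br e (z 1) (z 2) (z 4)) (ae := -br e (z 1) (z 2) (z 3)) (bc := br e (z 0) (z 3) (z 4))
    (bd := -br e (z 0) (z 2) (z 4)) (be := br e (z 0) (z 2) (z 3)) (cd := br e (z 0) (z 1) (z 4))
    (ce := -br e (z 0) (z 1) (z 3)) (hz 2 3 4) (neg_ne_zero.2 (hz 1 3 4)) (hz 1 2 4)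
    (neg_ne_zero.2 (hz 1 2 3)) (hz 0 3 4) (neg_ne_zero.2 (hz 0 2 4)) (hz 0 2 3) (hz 0 1 4)
    (neg_ne_zero.2 (hz 0 1 3)) ?_ ?_
  · rw [← key]
    simp only [crB, crLine_eq, br_swap12 e (z 0) (z 1), br_swap12 e (z 0) (z 2),
      br_swap12 e (z 0) (z 3), br_swap12 e (z 0) (z 4), br_swap12 e (z 1) (z 2),
      br_swap12 e (z 1) (z 3), br_swap12 e (z 1) (z 4), br_swap23 e _ (z 2) (z 3),
      br_swap23 e _ (z 2) (z 4), br_swap23 e _ (z 3) (z 4), neg_mul, mul_neg, neg_neg,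
      neg_div_neg_eq]
    ring_nf
    abel
  · have := br_pluecker e (z 4) (z 0) (z 1) (z 2) (z 3)
    simp only [br_swap12 e (z 0) (z 4), br_swap12 e (z 1) (z 4), br_swap12 e (z 2) (z 4),
      br_swap23 e _ (z 1) (z 4), br_swap23 e _ (z 2) (z 4), br_swap23 e _ (z 3) (z 4), neg_neg] at this
    linear_combination this
  · have := br_pluecker e (z 3) (z 0) (z 1) (z 2) (z 4)
    simp only [br_swap12 e (z 0) (z 3), br_swap12 e (z 1) (z 3), br_swap12 e (z 2) (z 3),
      br_swap23 e _ (z 1) (z 3), br_swap23 e _ (z 2) (z 3), neg_neg] at this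
    linear_combination this

lemma tripleRatioFrom4_eq (e : Pt F 4) (z : Fin 6 → Pt F 4) : tripleRatioFrom4 e z =
    br e (z 0) (z 1) (z 3) * br e (z 1) (z 2) (z 4) * br e (z 2) (z 0) (z 5) /
      (br e (z 0) (z 1) (z 4) * br e (z 1) (z 2) (z 5) * br e (z 2) (z 0) (z 3)) := rfl

/-- The auxiliary argument in the relation between a triple ratio and its transposed. -/
def auxRatio (e : Pt F 4) (z : Fin 6 → Pt F 4) : F :=
  br e (z 0) (z 1) (z 3) * br e (z 2) (z 5) (z 4) /
    (br e (z 0) (z 4) (z 3) * br e (z 2) (z 5) (z 1))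

lemma b2_tripleRatio_swap [Infinite F] {e : Pt F 4} {z : Fin 6 → Pt F 4} (h : PlaneGeneric e z) :
    b2 F (tripleRatioFrom4 e z) - b2 F (tripleRatioFrom4 e (z ∘ Equiv.swap 1 4)) =
      b2 F (auxRatio e z) - crB e (z 0) (z 1) (z 2) (z 4) (z 3) +
        crB e (z 2) (z 0) (z 1) (z 5) (z 4) := by
  have hz (a b c : Fin 6) (hab : a ≠ b := by decide) (hac : a ≠ c := by decide)
    (hbc : b ≠ c := by decide) := h a b c hab hac hbc
  have n013 := hz 0 1 3
  have n014 := hz 0 1 4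
  have n023 := hz 0 2 3
  have n024 := hz 0 2 4
  have n025 := hz 0 2 5
  have n124 := hz 1 2 4
  have n125 := hz 1 2 5
  have n012 := hz 0 1 2
  have n034 := hz 0 3 4
  have n245 := hz 2 4 5
  have p1 := br_pluecker e (z 0) (z 1) (z 2) (z 3) (z 4)
  have p2 := br_pluecker e (z 2) (z 0) (z 1) (z 4) (z 5)
  have s0 : (Equiv.swap (1 : Fin 6) 4) 0 = 0 := by decide
  have s1 : (Equiv.swap (1 : Fin 6) 4) 1 = 4 := by decide
  have s2 : (Equiv.swap (1 : Fin 6) 4) 2 = 2 := by decide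
  have s3 : (Equiv.swap (1 : Fin 6) 4) 3 = 3 := by decide
  have s4 : (Equiv.swap (1 : Fin 6) 4) 4 = 1 := by decide
  have s5 : (Equiv.swap (1 : Fin 6) 4) 5 = 5 := by decide
  simp only [tripleRatioFrom4_eq, auxRatio, crB, crLine_eq, Function.comp, s0, s1, s2, s3, s4,
    s5]
  simp only [br_swap12 e (z 0) (z 2), br_swap12 e (z 1) (z 2),
    br_swap12 e (z 2) (z 4), br_swap23 e _ (z 1) (z 2), br_swap23 e _ (z 1) (z 4),
    br_swap23 e _ (z 3) (z 4), br_swap23 e _ (z 1) (z 5), br_swap23 e _ (z 4) (z 5)] at p2 ⊢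
  generalize br e (z 0) (z 1) (z 3) = a013 at *
  generalize br e (z 0) (z 1) (z 4) = a014 at *
  generalize br e (z 0) (z 2) (z 3) = a023 at *
  generalize br e (z 0) (z 2) (z 4) = a024 at *
  generalize br e (z 0) (z 2) (z 5) = a025 at *
  generalize br e (z 1) (z 2) (z 4) = a124 at *
  generalize br e (z 1) (z 2) (z 5) = a125 at *
  generalize br e (z 0) (z 1) (z 2) = a012 at *
  generalize br e (z 0) (z 3) (z 4) = a034 at *
  generalize br e (z 2) (z 4) (z 5) = a245 at *
  have e1 : 1 - a014 * a023 / (a013 * a024) = a012 * a034 / (a013 * a024) := by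
    field_simp; linear_combination -p1
  have e2 : 1 - a025 * a124 / (a125 * a024) = a012 * a245 / (a125 * a024) := by
    field_simp; linear_combination -p2
  have m1 : a012 * a034 / (a013 * a024) ≠ 0 := by simp [*]
  have m2 : a012 * a245 / (a125 * a024) ≠ 0 := by simp [*]
  have key := b2_five (x := a014 * a023 / (a013 * a024)) (y := a025 * a124 / (a125 * a024))
    (by simp [*]) (fun h => m1 (by rw [← e1, h, sub_self]))
    (by simp [*]) (fun h => m2 (by rw [← e2, h, sub_self]))
  rw [e1, e2] at key
  have r1 : a025 * a124 / (a125 * a024) / (a014 * a023 / (a013 * a024)) =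
    a013 * a124 * -a025 / (a014 * a125 * -a023) := by field_simp
  have r2 : a012 * a245 / (a125 * a024) / (a012 * a034 / (a013 * a024)) =
    a013 * a245 / (a034 * a125) := by field_simp
  have r3 : a014 * a023 / (a013 * a024) * (a012 * a245 / (a125 * a024)) /
    (a025 * a124 / (a125 * a024) * (a012 * a034 / (a013 * a024))) =
    (a034 * a124 * a025 / (a014 * a245 * a023))⁻¹ := by field_simp
  rw [r1, r2, r3, b2_inv] at key
  rw [← sub_eq_zero, ← key]
  simp only [neg_mul, mul_neg, neg_neg, neg_div_neg_eq]
  ring_nf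
  abel


lemma tripleRatio_rotate (e : Pt F 4) (z : Fin 6 → Pt F 4) :
    tripleRatioFrom4 e ![z 1, z 2, z 0, z 4, z 5, z 3] = tripleRatioFrom4 e z := by
  simp only [tripleRatioFrom4_eq, Matrix.cons_val]
  congr 1 <;> ring

lemma tripleRatio_flip (e : Pt F 4) (z : Fin 6 → Pt F 4) :
    tripleRatioFrom4 e ![z 1, z 0, z 2, z 4, z 3, z 5] = (tripleRatioFrom4 e z)⁻¹ := by
  simp only [tripleRatioFrom4_eq, Matrix.cons_val, inv_div]
  rw [br_swap12 e (z 0) (z 1), br_swap12 e (z 0) (z 1), br_swap12 e (z 0) (z 2),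
    br_swap12 e (z 1) (z 2), br_swap12 e (z 0) (z 2), br_swap12 e (z 1) (z 2), ← neg_div_neg_eq]
  congr 1 <;> ring

/-- Alternation over the symmetric group. -/
def alt {n : ℕ} {X M : Type} [AddCommGroup M] (φ : (Fin n → X) → M) (z : Fin n → X) : M :=
  ∑ σ : Equiv.Perm (Fin n), (Equiv.Perm.sign σ : ℤ) • φ (z ∘ σ)

section alt
variable {n : ℕ} {X M : Type} [AddCommGroup M] {φ ψ : (Fin n → X) → M} {z : Fin n → X}

lemma alt_congr (h : ∀ σ : Equiv.Perm (Fin n), φ (z ∘ σ) = ψ (z ∘ σ)) : alt φ z = alt ψ z :=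
  Finset.sum_congr rfl fun σ _ => by rw [h]

lemma alt_add : alt (fun w => φ w + ψ w) z = alt φ z + alt ψ z := by
  simp only [alt, smul_add, Finset.sum_add_distrib]

lemma alt_neg : alt (fun w => -φ w) z = -alt φ z := by
  simp only [alt, smul_neg, Finset.sum_neg_distrib]

lemma alt_sub : alt (fun w => φ w - ψ w) z = alt φ z - alt ψ z := by
  simp only [alt, smul_sub, Finset.sum_sub_distrib]

lemma alt_comp (φ : (Fin n → X) → M) (z : Fin n → X) (ρ : Equiv.Perm (Fin n)) :
    alt (fun w => φ (w ∘ ρ)) z = (Equiv.Perm.sign ρ : ℤ) • alt φ z := by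
  simp only [alt, Finset.smul_sum, smul_smul]
  refine Fintype.sum_equiv (Equiv.mulRight ρ) _ _ fun σ => ?_
  have : (Equiv.Perm.sign ρ : ℤ) * Equiv.Perm.sign (σ * ρ) = Equiv.Perm.sign σ := by
    rcases Int.units_eq_one_or (Equiv.Perm.sign ρ) with h | h <;> simp [h]
  rw [Equiv.coe_mulRight, this]
  rfl

/-- Alternation is unchanged, up to the sign, by a permutation of the arguments. -/
lemma alt_perm (ρ : Equiv.Perm (Fin n)) (h : ∀ σ : Equiv.Perm (Fin n), φ (z ∘ σ) = ψ (z ∘ σ ∘ ρ)) :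
    alt φ z = (Equiv.Perm.sign ρ : ℤ) • alt ψ z := by
  rw [← alt_comp]
  exact alt_congr h

end alt

lemma alt_eq_of_perm {n : ℕ} {X M : Type} [AddCommGroup M] {φ ψ : (Fin n → X) → M}
    {z : Fin n → X} (ρ : Equiv.Perm (Fin n)) (hρ : Equiv.Perm.sign ρ = 1)
    (h : ∀ σ : Equiv.Perm (Fin n), φ (z ∘ σ) = ψ ((z ∘ σ) ∘ ρ)) : alt φ z = alt ψ z := by
  rw [alt_perm ρ h, hρ]; simp

lemma alt_eq_neg_of_perm {n : ℕ} {X M : Type} [AddCommGroup M] {φ ψ : (Fin n → X) → M}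
    {z : Fin n → X} (ρ : Equiv.Perm (Fin n)) (hρ : Equiv.Perm.sign ρ = -1)
    (h : ∀ σ : Equiv.Perm (Fin n), φ (z ∘ σ) = ψ ((z ∘ σ) ∘ ρ)) : alt φ z = -alt ψ z := by
  rw [alt_perm ρ h, hρ]; simp

/-- The class in `F^* ⊗ ℚ` of the determinant of four points of `P³`. -/
def fb (a b c d : Pt F 4) : FS F := fs F (br a b c d)

lemma fb_swap01 (a b c d : Pt F 4) : fb b a c d = fb a b c d := by
  rw [fb, br_swap01, fs_neg, fb]

lemma fb_swap12 (a b c d : Pt F 4) : fb a c b d = fb a b c d := by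
  rw [fb, br_swap12, fs_neg, fb]

lemma fb_swap23 (a b c d : Pt F 4) : fb a b d c = fb a b c d := by
  rw [fb, br_swap23, fs_neg, fb]

lemma Dmap_gen (a : F) : Dmap F (gen a) = b2 F a ⊗ₜ fs F a := by
  rw [gen]
  split_ifs with h
  · simp [h, b2_zero]
  · simp [Dmap]

lemma fs_tripleRatio {e : Pt F 4} {z : Fin 6 → Pt F 4} (h : PlaneGeneric e z) :
    fs F (tripleRatioFrom4 e z) =
      fb e (z 0) (z 1) (z 3) + fb e (z 1) (z 2) (z 4) + fb e (z 2) (z 0) (z 5) -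
        (fb e (z 0) (z 1) (z 4) + fb e (z 1) (z 2) (z 5) + fb e (z 2) (z 0) (z 3)) := by
  have hz (a b c : Fin 6) (hab : a ≠ b := by decide) (hac : a ≠ c := by decide)
    (hbc : b ≠ c := by decide) := h a b c hab hac hbc
  have n1 := hz 0 1 3
  have n2 := hz 1 2 4
  have n3 := hz 2 0 5
  have n4 := hz 0 1 4
  have n5 := hz 1 2 5
  have n6 := hz 2 0 3
  rw [tripleRatioFrom4_eq, fs_div (mul_ne_zero (mul_ne_zero n1 n2) n3)
    (mul_ne_zero (mul_ne_zero n4 n5) n6), fs_mul (mul_ne_zero n1 n2) n3, fs_mul n1 n2,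
    fs_mul (mul_ne_zero n4 n5) n6, fs_mul n4 n5]
  rfl

/-- The image of `r_3` under `δ_3`, in terms of cross-ratios and determinants. -/
lemma Dmap_r3From4 [Infinite F] {e : Pt F 4} {z : Fin 6 → Pt F 4} (h : PlaneGeneric e z) :
    Dmap F (r3From4 e z) = (-1 / 2 : ℚ) •
      alt (fun w => crB e (w 0) (w 1) (w 2) (w 3) (w 4) ⊗ₜ[ℚ] fb e (w 0) (w 1) (w 2)) z := by
  have hg (σ : Equiv.Perm (Fin 6)) : PlaneGeneric e (z ∘ σ) := h.comp σ.injective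
  set Q := alt (fun w => crB e (w 0) (w 1) (w 2) (w 3) (w 4) ⊗ₜ[ℚ] fb e (w 0) (w 1) (w 2)) z
    with hQ
  let T : (Fin 6 → Pt F 4) → T21 F := fun w =>
    b2 F (tripleRatioFrom4 e w) ⊗ₜ fb e (w 0) (w 1) (w 3)
  let U : (Fin 6 → Pt F 4) → T21 F := fun w =>
    b2 F (tripleRatioFrom4 e w) ⊗ₜ fb e (w 0) (w 1) (w 4)
  have hrot (w : Fin 6 → Pt F 4) : b2 F (tripleRatioFrom4 e w) ⊗ₜ fb e (w 1) (w 2) (w 4) =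
      T ![w 1, w 2, w 0, w 4, w 5, w 3] := by
    simp only [T, tripleRatio_rotate]; rfl
  have hrot2 (w : Fin 6 → Pt F 4) : b2 F (tripleRatioFrom4 e w) ⊗ₜ fb e (w 2) (w 0) (w 5) =
      T ![w 2, w 0, w 1, w 5, w 3, w 4] := by
    have := hrot ![w 1, w 2, w 0, w 4, w 5, w 3]
    rw [tripleRatio_rotate] at this
    exact this
  have hrotU (w : Fin 6 → Pt F 4) : b2 F (tripleRatioFrom4 e w) ⊗ₜ fb e (w 1) (w 2) (w 5) =
      U ![w 1, w 2, w 0, w 4, w 5, w 3] := by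
    simp only [U, tripleRatio_rotate]; rfl
  have hrotU2 (w : Fin 6 → Pt F 4) : b2 F (tripleRatioFrom4 e w) ⊗ₜ fb e (w 2) (w 0) (w 3) =
      U ![w 2, w 0, w 1, w 5, w 3, w 4] := by
    have := hrotU ![w 1, w 2, w 0, w 4, w 5, w 3]
    rw [tripleRatio_rotate] at this
    exact this
  have hflip (w : Fin 6 → Pt F 4) : T w = -U ![w 1, w 0, w 2, w 4, w 3, w 5] := by
    simp only [T, U, tripleRatio_flip, b2_inv, TensorProduct.neg_tmul, neg_neg, Matrix.cons_val]
    rw [fb_swap12]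
  let rot : Equiv.Perm (Fin 6) :=
    ⟨![1, 2, 0, 4, 5, 3], ![2, 0, 1, 5, 3, 4], by decide, by decide⟩
  have hrot_apply (w : Fin 6 → Pt F 4) : w ∘ rot = ![w 1, w 2, w 0, w 4, w 5, w 3] := by
    ext1 i; fin_cases i <;> rfl
  have hrot_apply' (w : Fin 6 → Pt F 4) : w ∘ rot.symm = ![w 2, w 0, w 1, w 5, w 3, w 4] := by
    ext1 i; fin_cases i <;> rfl
  let flip : Equiv.Perm (Fin 6) :=
    ⟨![1, 0, 2, 4, 3, 5], ![1, 0, 2, 4, 3, 5], by decide, by decide⟩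
  have hflip_apply (w : Fin 6 → Pt F 4) : w ∘ flip = ![w 1, w 0, w 2, w 4, w 3, w 5] := by
    ext1 i; fin_cases i <;> rfl
  have hTU : alt T z = -alt U z := by
    rw [← alt_neg]
    exact alt_eq_of_perm flip (by decide) fun σ => by rw [hflip_apply, hflip]
  have hD : (15 : ℚ) • Dmap F (r3From4 e z) = (6 : ℚ) • alt T z := by
    have : Dmap F (r3From4 e z) = (1 / 15 : ℚ) •
        alt (fun w => b2 F (tripleRatioFrom4 e w) ⊗ₜ fs F (tripleRatioFrom4 e w)) z := by
      simp only [r3From4, map_smul, map_sum, map_zsmul, Dmap_gen, alt]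
    rw [this, smul_smul, mul_one_div_cancel (by norm_num), one_smul]
    have : alt (fun w => b2 F (tripleRatioFrom4 e w) ⊗ₜ[ℚ] fs F (tripleRatioFrom4 e w)) z =
        alt (fun w => (T w + T ![w 1, w 2, w 0, w 4, w 5, w 3] +
          T ![w 2, w 0, w 1, w 5, w 3, w 4]) - (U w + U ![w 1, w 2, w 0, w 4, w 5, w 3] +
          U ![w 2, w 0, w 1, w 5, w 3, w 4])) z := by
      refine alt_congr fun σ => ?_
      rw [fs_tripleRatio (hg σ)]
      simp only [TensorProduct.tmul_sub, TensorProduct.tmul_add, hrot, hrot2, hrotU, hrotU2]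
      rfl
    rw [this]
    simp only [alt_sub, alt_add]
    simp only [← hrot_apply, ← hrot_apply', alt_comp]
    rw [show Equiv.Perm.sign rot = 1 by decide, show Equiv.Perm.sign rot.symm = 1 by decide, hTU]
    simp only [Units.val_one, one_smul]
    module
  let V₁ : (Fin 6 → Pt F 4) → T21 F := fun w =>
    crB e (w 0) (w 1) (w 2) (w 4) (w 3) ⊗ₜ fb e (w 0) (w 1) (w 4)
  let V₂ : (Fin 6 → Pt F 4) → T21 F := fun w =>
    crB e (w 2) (w 0) (w 1) (w 5) (w 4) ⊗ₜ fb e (w 0) (w 1) (w 4)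
  let V₀ : (Fin 6 → Pt F 4) → T21 F := fun w =>
    b2 F (auxRatio e w) ⊗ₜ fb e (w 0) (w 1) (w 4)
  let Q₂ : (Fin 6 → Pt F 4) → T21 F := fun w =>
    crB e (w 3) (w 0) (w 1) (w 2) (w 4) ⊗ₜ fb e (w 0) (w 1) (w 2)
  have hU : (2 : ℚ) • alt U z = alt V₀ z - alt V₁ z + alt V₂ z := by
    rw [← alt_sub, ← alt_add]
    have : alt U z = -alt (fun w => b2 F (tripleRatioFrom4 e (w ∘ Equiv.swap 1 4)) ⊗ₜ[ℚ]
        fb e (w 0) (w 1) (w 4)) z := by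
      refine alt_eq_neg_of_perm (Equiv.swap 1 4) (by decide) fun σ => ?_
      have s0 : (Equiv.swap (1 : Fin 6) 4) 0 = 0 := by decide
      have s1 : (Equiv.swap (1 : Fin 6) 4) 1 = 4 := by decide
      have s4 : (Equiv.swap (1 : Fin 6) 4) 4 = 1 := by decide
      have ss : ((z ∘ σ) ∘ Equiv.swap 1 4) ∘ Equiv.swap 1 4 = z ∘ σ := by ext1; simp
      rw [ss]
      simp only [U, Function.comp_apply, s0, s1, s4]
      rw [fb_swap23]
    rw [two_smul]
    nth_rewrite 2 [this]
    rw [← sub_eq_add_neg, ← alt_sub]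
    refine alt_congr fun σ => ?_
    simp only [U, V₀, V₁, V₂, ← TensorProduct.sub_tmul, ← TensorProduct.add_tmul]
    rw [b2_tripleRatio_swap (hg σ)]
  have hV₀ : alt V₀ z = 0 := by
    have : alt V₀ z = -alt V₀ z := by
      refine alt_eq_neg_of_perm (Equiv.swap 2 5) (by decide) fun σ => ?_
      have s0 : (Equiv.swap (2 : Fin 6) 5) 0 = 0 := by decide
      have s1 : (Equiv.swap (2 : Fin 6) 5) 1 = 1 := by decide
      have s2 : (Equiv.swap (2 : Fin 6) 5) 2 = 5 := by decide
      have s3 : (Equiv.swap (2 : Fin 6) 5) 3 = 3 := by decide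
      have s4 : (Equiv.swap (2 : Fin 6) 5) 4 = 4 := by decide
      have s5 : (Equiv.swap (2 : Fin 6) 5) 5 = 2 := by decide
      simp only [V₀, auxRatio, Function.comp_apply, s0, s1, s2, s3, s4, s5]
      rw [br_swap12 e (z (σ 2)) (z (σ 5)), br_swap12 e (z (σ 2)) (z (σ 5)), mul_neg, mul_neg,
        neg_div_neg_eq]
    have h2 : (2 : ℚ) • alt V₀ z = 0 := by
      rw [two_smul]
      nth_rewrite 1 [this]
      exact neg_add_cancel _
    exact (smul_eq_zero.1 h2).resolve_left two_ne_zero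
  have hz (σ : Equiv.Perm (Fin 6)) (a b c : Fin 6) (hab : a ≠ b := by decide)
    (hac : a ≠ c := by decide) (hbc : b ≠ c := by decide) := hg σ a b c hab hac hbc
  have hV₁ : alt V₁ z = -Q := by
    refine alt_eq_neg_of_perm (Equiv.swap 2 4) (by decide) fun σ => ?_
    change V₁ (z ∘ σ) = crB e ((z ∘ σ) 0) ((z ∘ σ) 1) ((z ∘ σ) 4) ((z ∘ σ) 3) ((z ∘ σ) 2) ⊗ₜ[ℚ]
        fb e ((z ∘ σ) 0) ((z ∘ σ) 1) ((z ∘ σ) 4)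
    simp only [V₁]
    rw [crB_swap12 e ((z ∘ σ) 0) _ ((z ∘ σ) 3) ((z ∘ σ) 4) ((z ∘ σ) 2) (hz σ 0 1 2) (hz σ 0 3 4),
      crB_swap23 _ _ _ ((z ∘ σ) 3) ((z ∘ σ) 2) ((z ∘ σ) 4),
      crB_swap12 e ((z ∘ σ) 0) _ ((z ∘ σ) 2) ((z ∘ σ) 3) ((z ∘ σ) 4) (hz σ 0 1 4) (hz σ 0 2 3),
      crB_swap23 _ _ _ _ ((z ∘ σ) 3) ((z ∘ σ) 4)]
    simp
  have hV₂ : alt V₂ z = alt Q₂ z := by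
    rw [← neg_neg (alt Q₂ z), ← alt_neg]
    refine alt_eq_neg_of_perm ⟨![0, 1, 4, 2, 5, 3], ![0, 1, 3, 5, 2, 4], by decide, by decide⟩
      (by decide) fun σ => ?_
    change V₂ (z ∘ σ) = -(crB e ((z ∘ σ) 2) ((z ∘ σ) 0) ((z ∘ σ) 1) ((z ∘ σ) 4) ((z ∘ σ) 5) ⊗ₜ[ℚ]
        fb e ((z ∘ σ) 0) ((z ∘ σ) 1) ((z ∘ σ) 4))
    simp only [V₂]
    rw [crB_swap23, TensorProduct.neg_tmul]
  have hQ₂ : (2 : ℚ) • alt Q₂ z = (3 : ℚ) • Q := by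
    have h0 : alt (fun w => crB e (w 1) (w 0) (w 2) (w 3) (w 4) ⊗ₜ[ℚ] fb e (w 0) (w 1) (w 2)) z =
        -Q := by
      refine alt_eq_neg_of_perm (Equiv.swap 0 1) (by decide) fun σ => ?_
      change _ = crB e (z (σ 1)) (z (σ 0)) (z (σ 2)) (z (σ 3)) (z (σ 4)) ⊗ₜ[ℚ]
        fb e (z (σ 1)) (z (σ 0)) (z (σ 2))
      rw [fb_swap12]
      rfl
    have h1 : alt (fun w => crB e (w 2) (w 0) (w 1) (w 3) (w 4) ⊗ₜ[ℚ] fb e (w 0) (w 1) (w 2)) z =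
        Q := by
      refine alt_eq_of_perm ⟨![2, 0, 1, 3, 4, 5], ![1, 2, 0, 3, 4, 5], by decide, by decide⟩
        (by decide) fun σ => ?_
      change _ = crB e (z (σ 2)) (z (σ 0)) (z (σ 1)) (z (σ 3)) (z (σ 4)) ⊗ₜ[ℚ]
        fb e (z (σ 2)) (z (σ 0)) (z (σ 1))
      rw [fb_swap12 e (z (σ 0)) (z (σ 2)) (z (σ 1)), fb_swap23 e (z (σ 0)) (z (σ 1)) (z (σ 2))]
      rfl
    have h2 : alt (fun w => crB e (w 4) (w 0) (w 1) (w 2) (w 3) ⊗ₜ[ℚ] fb e (w 0) (w 1) (w 2)) z =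
        -alt Q₂ z := alt_eq_neg_of_perm (Equiv.swap 3 4) (by decide) fun σ => rfl
    have key : Q - -Q + Q - alt Q₂ z + -alt Q₂ z = 0 := by
      rw [← h2, ← h0]
      nth_rewrite 2 [← h1]
      rw [hQ]
      simp only [← alt_sub, ← alt_add, Q₂]
      refine (alt_congr (ψ := fun _ => 0) fun σ => ?_).trans (by simp [alt])
      simp only [← TensorProduct.sub_tmul, ← TensorProduct.add_tmul]
      have hf : Function.Injective (Fin.castSucc : Fin 5 → Fin 6) := Fin.castSucc_injective 5
      refine (congrArg (fun x => x ⊗ₜ[ℚ] fb e _ _ _) (crB_five_centers ((hg σ).comp hf))).trans ?_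
      simp
    linear_combination (norm := module) -key
  have hU' : (2 : ℚ) • alt U z = (5 / 2 : ℚ) • Q := by
    rw [hU, hV₀, hV₁, hV₂]
    linear_combination (norm := module) (1 / 2 : ℚ) • hQ₂
  linear_combination (norm := module) (1 / 15 : ℚ) • hD + (2 / 5 : ℚ) • hTU - (1 / 5 : ℚ) • hU'

lemma alt_succ {n : ℕ} {X M : Type} [AddCommGroup M] (φ : (Fin (n + 1) → X) → M)
    (z : Fin (n + 1) → X) : alt φ z =
      ∑ i : Fin (n + 1), ((-1 : ℤ) ^ (i : ℕ)) • alt (fun w => φ (Fin.cons (z i) w)) (z ∘ i.succAbove) := by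
  let f : Fin (n + 1) × Equiv.Perm (Fin n) → Equiv.Perm (Fin (n + 1)) := fun x =>
    x.1.cycleRange.symm * Equiv.Perm.decomposeFin.symm (0, x.2)
  have f_zero (x) : f x 0 = x.1 := by simp [f, Fin.cycleRange_symm_zero]
  have f_succ (x) (k : Fin n) : f x k.succ = x.1.succAbove (x.2 k) := by
    simp [f, Fin.cycleRange_symm_succ]
  have hf : Function.Bijective f := by
    rw [Fintype.bijective_iff_injective_and_card]
    refine ⟨fun x y hxy => ?_, by simp [Fintype.card_perm, Nat.factorial_succ]⟩
    have h0 : x.1 = y.1 := by rw [← f_zero, hxy, f_zero]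
    refine Prod.ext h0 (Equiv.ext fun k => ?_)
    have := f_succ x k
    rw [hxy, f_succ, h0] at this
    exact (Fin.succAbove_right_injective this).symm
  rw [alt, ← hf.sum_comp, Fintype.sum_prod_type]
  refine Finset.sum_congr rfl fun i _ => ?_
  rw [alt, Finset.smul_sum]
  refine Finset.sum_congr rfl fun ρ _ => ?_
  have h1 : z ∘ f (i, ρ) = Fin.cons (z i) ((z ∘ i.succAbove) ∘ ρ) := by
    ext1 k
    refine Fin.cases ?_ (fun k => ?_) k
    · simp [f_zero]
    · simp [f_succ]
  have h2 : (Equiv.Perm.sign (f (i, ρ)) : ℤ) = (-1) ^ (i : ℕ) * Equiv.Perm.sign ρ := by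
    simp [f, Fin.sign_cycleRange]
  rw [h1, h2, smul_smul]

lemma crB_perm [Infinite F] {p q : Pt F 4} {z : Fin 4 → Pt F 4} (h : LineGeneric p q z)
    (ρ : Equiv.Perm (Fin 4)) : crB p q (z (ρ 0)) (z (ρ 1)) (z (ρ 2)) (z (ρ 3)) =
      (Equiv.Perm.sign ρ : ℤ) • crB p q (z 0) (z 1) (z 2) (z 3) := by
  have hρ : ρ ∈ Submonoid.closure (Set.range fun i : Fin 3 => Equiv.swap i.castSucc i.succ) := by
    rw [Equiv.Perm.mclosure_swap_castSucc_succ]; trivial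
  induction hρ using Submonoid.closure_induction_right with
  | one => simp
  | mul_right σ _ τ hτ ih =>
    obtain ⟨i, rfl⟩ := hτ
    have hz (a b : Fin 4) (hab : a ≠ b := by decide) := h (σ a) (σ b) (σ.injective.ne hab)
    rw [Equiv.Perm.sign_mul, Equiv.Perm.sign_swap (Fin.castSucc_lt_succ).ne]
    simp only [mul_neg, mul_one, Units.val_neg, neg_smul, ← ih, Equiv.Perm.mul_apply]
    fin_cases i
    · exact crB_swap01 ..
    · exact crB_swap12 _ _ _ _ _ _ (hz 0 3) (hz 1 2)
    · exact crB_swap23 ..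

lemma sum_perm_four {M : Type} [AddCommGroup M] (g : Fin 4 → Fin 4 → M)
    (hg : ∀ a b, g a b = g b a) : ∑ ρ : Equiv.Perm (Fin 4), g (ρ 0) (ρ 1) =
      (4 : ℤ) • (g 0 1 + g 2 3 + g 0 2 + g 0 3 + g 1 2 + g 1 3) := by
  have key {n : ℕ} (f : Equiv.Perm (Fin (n + 1)) → M) : ∑ ρ, f ρ =
      ∑ i, ∑ ρ, f (Equiv.Perm.decomposeFin.symm (i, ρ)) := by
    rw [← Fintype.sum_prod_type', Equiv.sum_comp Equiv.Perm.decomposeFin.symm]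
  have key2 (f : Fin 3 → M) : ∑ ρ : Equiv.Perm (Fin 3), f (ρ 0) = (2 : ℤ) • (f 0 + f 1 + f 2) := by
    rw [key]
    simp [Fin.sum_univ_three, Fintype.card_perm]
    abel
  rw [key]
  have h0 (i : Fin 4) (ρ : Equiv.Perm (Fin 3)) : Equiv.Perm.decomposeFin.symm (i, ρ) 0 = i := by
    simp
  have h1 (i : Fin 4) (ρ : Equiv.Perm (Fin 3)) :
      Equiv.Perm.decomposeFin.symm (i, ρ) 1 = Equiv.swap 0 i (ρ 0).succ :=
    Equiv.Perm.decomposeFin_symm_apply_succ ρ i 0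
  simp only [h0, h1]
  simp only [fun i => key2 fun k => g i (Equiv.swap 0 i k.succ)]
  have e1 : (Equiv.swap (0 : Fin 4) 1) (Fin.succ 0) = 0 := by decide
  have e2 : (Equiv.swap (0 : Fin 4) 1) (Fin.succ 1) = 2 := by decide
  have e3 : (Equiv.swap (0 : Fin 4) 1) (Fin.succ 2) = 3 := by decide
  have e4 : (Equiv.swap (0 : Fin 4) 2) (Fin.succ 0) = 1 := by decide
  have e5 : (Equiv.swap (0 : Fin 4) 2) (Fin.succ 1) = 0 := by decide
  have e6 : (Equiv.swap (0 : Fin 4) 2) (Fin.succ 2) = 3 := by decide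
  have e7 : (Equiv.swap (0 : Fin 4) 3) (Fin.succ 0) = 1 := by decide
  have e8 : (Equiv.swap (0 : Fin 4) 3) (Fin.succ 1) = 2 := by decide
  have e9 : (Equiv.swap (0 : Fin 4) 3) (Fin.succ 2) = 0 := by decide
  have f1 : (Fin.succ 0 : Fin 4) = 1 := rfl
  have f2 : (Fin.succ 1 : Fin 4) = 2 := rfl
  have f3 : (Fin.succ 2 : Fin 4) = 3 := rfl
  rw [Fin.sum_univ_four, e1, e2, e3, e4, e5, e6, e7, e8, e9, Equiv.swap_self, Equiv.refl_apply,
    Equiv.refl_apply, Equiv.refl_apply, f1, f2, f3, hg 1 0, hg 2 0, hg 3 0, hg 2 1, hg 3 1, hg 3 2]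
  abel

/-- The tensor of the cross-ratio of four points of the plane seen from a fifth point with the
sum of the six determinants through that point. -/
def crSix (e p a b c d : Pt F 4) : T21 F :=
  crB e p a b c d ⊗ₜ (fb e p a b + fb e p c d + fb e p a c + fb e p a d + fb e p b c + fb e p b d)

lemma alt_crB_fb [Infinite F] {e p : Pt F 4} {u : Fin 4 → Pt F 4} (h : LineGeneric e p u) :
    alt (fun w => crB e p (w 0) (w 1) (w 2) (w 3) ⊗ₜ[ℚ] fb e p (w 0) (w 1)) u =
      (4 : ℤ) • crSix e p (u 0) (u 1) (u 2) (u 3) := by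
  have hs := sum_perm_four (fun a b => fb e p (u a) (u b)) (fun _ _ => fb_swap23 _ _ _ _)
  rw [crSix, ← TensorProduct.tmul_smul]
  refine Eq.trans ?_ (congrArg (fun x => crB e p (u 0) (u 1) (u 2) (u 3) ⊗ₜ[ℚ] x) hs)
  rw [TensorProduct.tmul_sum, alt]
  refine Finset.sum_congr rfl fun σ _ => ?_
  simp only [Function.comp_apply]
  rw [crB_perm h]
  rcases Int.units_eq_one_or (Equiv.Perm.sign σ) with h | h <;>
    simp [h, TensorProduct.neg_tmul]

/-- The image of `r_3` under `δ_3`: a signed sum over an omitted point and a centre. -/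
lemma Dmap_r3From4_eq_sum [Infinite F] {e : Pt F 4} {z : Fin 6 → Pt F 4} (h : PlaneGeneric e z) :
    Dmap F (r3From4 e z) = (2 : ℤ) • ∑ t : Fin 6, ((-1 : ℤ) ^ (t : ℕ)) •
      ∑ p : Fin 5, ((-1 : ℤ) ^ (p : ℕ)) • crSix e (z (t.succAbove p))
        (z (t.succAbove (p.succAbove 0))) (z (t.succAbove (p.succAbove 1)))
        (z (t.succAbove (p.succAbove 2))) (z (t.succAbove (p.succAbove 3))) := by
  have h1 : alt (fun w => crB e (w 0) (w 1) (w 2) (w 3) (w 4) ⊗ₜ[ℚ] fb e (w 0) (w 1) (w 2)) z =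
      -alt (fun w => crB e (w 1) (w 2) (w 3) (w 4) (w 5) ⊗ₜ[ℚ] fb e (w 1) (w 2) (w 3)) z :=
    alt_eq_neg_of_perm ⟨![5, 0, 1, 2, 3, 4], ![1, 2, 3, 4, 5, 0], by decide, by decide⟩
      (by decide) fun σ => rfl
  have h2 : alt (fun w => crB e (w 1) (w 2) (w 3) (w 4) (w 5) ⊗ₜ[ℚ] fb e (w 1) (w 2) (w 3)) z =
      (4 : ℤ) • ∑ t : Fin 6, ((-1 : ℤ) ^ (t : ℕ)) •
      ∑ p : Fin 5, ((-1 : ℤ) ^ (p : ℕ)) • crSix e (z (t.succAbove p))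
        (z (t.succAbove (p.succAbove 0))) (z (t.succAbove (p.succAbove 1)))
        (z (t.succAbove (p.succAbove 2))) (z (t.succAbove (p.succAbove 3))) := by
    rw [alt_succ, Finset.smul_sum]
    refine Finset.sum_congr rfl fun t _ => ?_
    rw [smul_comm]
    refine congrArg (((-1 : ℤ) ^ (t : ℕ)) • ·) ?_
    rw [alt_succ, Finset.smul_sum]
    refine Finset.sum_congr rfl fun p _ => ?_
    rw [smul_comm]
    refine congrArg (((-1 : ℤ) ^ (p : ℕ)) • ·) ?_
    refine alt_crB_fb (e := e) (p := z (t.succAbove p))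
      (u := (z ∘ t.succAbove) ∘ p.succAbove) fun a b hab => ?_
    exact h _ _ _ (Fin.succAbove_right_injective.ne (Fin.succAbove_ne p a).symm)
      (Fin.succAbove_right_injective.ne (Fin.succAbove_ne p b).symm)
      (Fin.succAbove_right_injective.ne (Fin.succAbove_right_injective.ne hab))
  rw [Dmap_r3From4 h, h1, h2]
  module

section boundary
variable {X M : Type} [AddCommGroup M]

/-- The alternating sum over one distinguished entry among three. -/
def sumThree (f : X → X → X → M) (x y z : X) : M := f x y z - f y x z + f z x y

/-- The alternating sum over one distinguished entry among four. -/
def sumFour (f : X → X → X → X → M) (l : Fin 4 → X) : M :=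
  f (l 0) (l 1) (l 2) (l 3) - f (l 1) (l 0) (l 2) (l 3) + f (l 2) (l 0) (l 1) (l 3) -
    f (l 3) (l 0) (l 1) (l 2)

lemma sumFour_eq_sum (f : X → X → X → X → M) (l : Fin 4 → X) : sumFour f l =
    ∑ i : Fin 4, ((-1 : ℤ) ^ (i : ℕ)) •
      f (l i) (l (i.succAbove 0)) (l (i.succAbove 1)) (l (i.succAbove 2)) := by
  rw [Fin.sum_univ_four, sumFour]
  change _ = ((-1 : ℤ) ^ 0) • f (l 0) (l 1) (l 2) (l 3) +
    ((-1 : ℤ) ^ 1) • f (l 1) (l 0) (l 2) (l 3) + ((-1 : ℤ) ^ 2) • f (l 2) (l 0) (l 1) (l 3) +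
    ((-1 : ℤ) ^ 3) • f (l 3) (l 0) (l 1) (l 2)
  simp
  abel

lemma sumFour_congr {f g : X → X → X → X → M} {l : Fin 4 → X}
    (h : ∀ i : Fin 4, f (l i) (l (i.succAbove 0)) (l (i.succAbove 1)) (l (i.succAbove 2)) =
      g (l i) (l (i.succAbove 0)) (l (i.succAbove 1)) (l (i.succAbove 2))) :
    sumFour f l = sumFour g l := by
  simp only [sumFour_eq_sum, h]

lemma sumFour_add (f g : X → X → X → X → M) (l : Fin 4 → X) :
    sumFour (fun e a b c => f e a b c + g e a b c) l = sumFour f l + sumFour g l := by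
  simp only [sumFour]; abel

lemma sumFour_neg (f : X → X → X → X → M) (l : Fin 4 → X) :
    sumFour (fun e a b c => -f e a b c) l = -sumFour f l := by
  simp only [sumFour]; abel

lemma sumFour_sub (f g : X → X → X → X → M) (l : Fin 4 → X) :
    sumFour (fun e a b c => f e a b c - g e a b c) l = sumFour f l - sumFour g l := by
  simp only [sumFour]; abel

lemma sumFour_zsmul (n : ℤ) (f : X → X → X → X → M) (l : Fin 4 → X) :
    sumFour (fun e a b c => n • f e a b c) l = n • sumFour f l := by
  simp only [sumFour, smul_add, smul_sub]

lemma sumFour_comm (f : X → X → X → X → X → X → X → X → M) (l m : Fin 4 → X) :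
    sumFour (fun e a b c => sumFour (fun x p q r => f e a b c x p q r) m) l =
      sumFour (fun x p q r => sumFour (fun e a b c => f e a b c x p q r) l) m := by
  simp only [sumFour]; abel

/-- Exchanging the two points omitted one after the other changes the sign. -/
lemma sumFour_sumThree_flip (f : X → X → X → X → M) (l : Fin 4 → X) :
    sumFour (fun e a b c => sumThree (fun t p q => f t e p q) a b c) l =
      -sumFour (fun e a b c => sumThree (fun t p q => f e t p q) a b c) l := by
  simp only [sumFour, sumThree]; abel

lemma sumFour_sumThree_eq_zero (f : X → X → M) (l : Fin 4 → X) :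
    sumFour (fun _ a b c => sumThree (fun _ p q => f p q) a b c) l = 0 := by
  simp only [sumFour, sumThree]; abel

lemma sumFour_sumThree_eq_zero_of_symm (f : X → X → X → X → M)
    (hf : ∀ x y p q, f x y p q = f y x p q) (l : Fin 4 → X) :
    sumFour (fun e a b c => sumThree (fun t p q => f e t p q) a b c) l = 0 := by
  simp only [sumFour, sumThree, hf (l 1) (l 0), hf (l 2) (l 0), hf (l 3) (l 0), hf (l 2) (l 1),
    hf (l 3) (l 1), hf (l 3) (l 2)]
  abel

lemma sumFour_pair_eq_zero_of_symm (f : X → X → X → M) (hf : ∀ x y p, f x y p = f y x p)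
    (l : Fin 4 → X) :
    sumFour (fun e a b c => sumThree (fun _ p q => f e p q - f e q p) a b c) l = 0 := by
  simp only [sumFour, sumThree, hf (l 1) (l 0), hf (l 2) (l 0), hf (l 3) (l 0), hf (l 2) (l 1),
    hf (l 3) (l 1), hf (l 3) (l 2)]
  abel

end boundary

lemma crSix_comm (e p a b c d : Pt F 4) : crSix p e a b c d = crSix e p a b c d := by
  simp only [crSix, crB_comm e p, fb_swap01 e p]

lemma Dmap_r3From4_cons [Infinite F] {e a b c x y w : Pt F 4}
    (h : PlaneGeneric e ![a, b, c, x, y, w]) :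
    Dmap F (r3From4 e ![a, b, c, x, y, w]) = (2 : ℤ) • (
      sumThree (fun _ b c => crSix e b c x y w - crSix e c b x y w) a b c +
      sumThree (fun _ b c => sumThree (fun x y w => crSix e x b c y w) x y w) a b c -
      sumThree (fun _ y w => crSix e a b c y w - crSix e b a c y w + crSix e c a b y w -
        crSix e y a b c w + crSix e w a b c y) x y w) := by
  rw [Dmap_r3From4_eq_sum h]
  refine congrArg ((2 : ℤ) • ·) ?_
  simp only [sumThree]
  have key (f : Fin 6 → Fin 6 → Fin 6 → Fin 6 → Fin 6 → T21 F) :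
      ∑ t : Fin 6, ((-1 : ℤ) ^ (t : ℕ)) • ∑ p : Fin 5, ((-1 : ℤ) ^ (p : ℕ)) •
        f (t.succAbove p) (t.succAbove (p.succAbove 0)) (t.succAbove (p.succAbove 1))
          (t.succAbove (p.succAbove 2)) (t.succAbove (p.succAbove 3)) =
      (f 1 2 3 4 5 - f 2 1 3 4 5 + f 3 1 2 4 5 - f 4 1 2 3 5 + f 5 1 2 3 4) -
      (f 0 2 3 4 5 - f 2 0 3 4 5 + f 3 0 2 4 5 - f 4 0 2 3 5 + f 5 0 2 3 4) +
      (f 0 1 3 4 5 - f 1 0 3 4 5 + f 3 0 1 4 5 - f 4 0 1 3 5 + f 5 0 1 3 4) -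
      (f 0 1 2 4 5 - f 1 0 2 4 5 + f 2 0 1 4 5 - f 4 0 1 2 5 + f 5 0 1 2 4) +
      (f 0 1 2 3 5 - f 1 0 2 3 5 + f 2 0 1 3 5 - f 3 0 1 2 5 + f 5 0 1 2 3) -
      (f 0 1 2 3 4 - f 1 0 2 3 4 + f 2 0 1 3 4 - f 3 0 1 2 4 + f 4 0 1 2 3) := by
    simp only [Fin.sum_univ_six, Fin.sum_univ_five]
    simp [Fin.succAbove, Fin.lt_def]
    abel
  refine (key fun i j k l m => crSix e (![a, b, c, x, y, w] i) (![a, b, c, x, y, w] j)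
    (![a, b, c, x, y, w] k) (![a, b, c, x, y, w] l) (![a, b, c, x, y, w] m)).trans ?_
  simp only [Matrix.cons_val]
  abel

/-- A tuple of points of `P³` any four of which are independent. -/
def SpaceGeneric {n : ℕ} (z : Fin n → Pt F 4) : Prop :=
  ∀ a b c d, a ≠ b → a ≠ c → a ≠ d → b ≠ c → b ≠ d → c ≠ d → br (z a) (z b) (z c) (z d) ≠ 0

lemma GenericPair.spaceGeneric {l m : Fin 4 → Pt F 4} (h : GenericPair l m) (i j : Fin 4) :
    SpaceGeneric ![l i, l (i.succAbove 0), l (i.succAbove 1), l (i.succAbove 2),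
      m j, m (j.succAbove 0), m (j.succAbove 1), m (j.succAbove 2)] := by
  let f : Fin 8 → Fin 8 := Fin.append
    (Fin.cons (Fin.castAdd 4 i) fun k : Fin 3 => Fin.castAdd 4 (i.succAbove k))
    (Fin.cons (Fin.natAdd 4 j) fun k : Fin 3 => Fin.natAdd 4 (j.succAbove k))
  have hf : Function.Injective f := by revert i j; decide
  have hz : ![l i, l (i.succAbove 0), l (i.succAbove 1), l (i.succAbove 2),
      m j, m (j.succAbove 0), m (j.succAbove 1), m (j.succAbove 2)] = Fin.append l m ∘ f := by
    ext1 k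
    fin_cases k
    · exact (Fin.append_left l m i).symm
    · exact (Fin.append_left l m (i.succAbove 0)).symm
    · exact (Fin.append_left l m (i.succAbove 1)).symm
    · exact (Fin.append_left l m (i.succAbove 2)).symm
    · exact (Fin.append_right l m j).symm
    · exact (Fin.append_right l m (j.succAbove 0)).symm
    · exact (Fin.append_right l m (j.succAbove 1)).symm
    · exact (Fin.append_right l m (j.succAbove 2)).symm
  rw [hz]
  exact fun a b c d h1 h2 h3 h4 h5 h6 => h _ _ _ _ (hf.ne h1) (hf.ne h2) (hf.ne h3) (hf.ne h4)
    (hf.ne h5) (hf.ne h6)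

lemma SpaceGeneric.planeGeneric {n k : ℕ} {z : Fin n → Pt F 4} (h : SpaceGeneric z) (i : Fin n)
    (f : Fin k → Fin n) (hf : Function.Injective f) (hi : ∀ j, i ≠ f j) :
    PlaneGeneric (z i) (z ∘ f) :=
  fun _ _ _ hab hac hbc => h _ _ _ _ (hi _) (hi _) (hi _) (hf.ne hab) (hf.ne hac) (hf.ne hbc)

lemma succAbove_vec_eq {X : Type} (l m : Fin 4 → X) (i j : Fin 4) :
    ![l (i.succAbove 0), l (i.succAbove 1), l (i.succAbove 2), m (j.succAbove 0),
      m (j.succAbove 1), m (j.succAbove 2)] =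
    ![l i, l (i.succAbove 0), l (i.succAbove 1), l (i.succAbove 2),
      m j, m (j.succAbove 0), m (j.succAbove 1), m (j.succAbove 2)] ∘ ![1, 2, 3, 5, 6, 7] := by
  ext1 t; fin_cases t <;> rfl

lemma GenericPair.planeGeneric_left {l m : Fin 4 → Pt F 4} (h : GenericPair l m) (i j : Fin 4) :
    PlaneGeneric (l i) ![l (i.succAbove 0), l (i.succAbove 1), l (i.succAbove 2),
      m (j.succAbove 0), m (j.succAbove 1), m (j.succAbove 2)] := by
  rw [succAbove_vec_eq l m i j]
  exact (h.spaceGeneric i j).planeGeneric 0 _ (by decide) (by decide)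

lemma GenericPair.planeGeneric_right {l m : Fin 4 → Pt F 4} (h : GenericPair l m) (i j : Fin 4) :
    PlaneGeneric (m j) ![l (i.succAbove 0), l (i.succAbove 1), l (i.succAbove 2),
      m (j.succAbove 0), m (j.succAbove 1), m (j.succAbove 2)] := by
  rw [succAbove_vec_eq l m i j]
  exact (h.spaceGeneric i j).planeGeneric 4 _ (by decide) (by decide)

lemma Dmap_a3p [Infinite F] {l m : Fin 4 → Pt F 4} (h : GenericPair l m) :
    Dmap F (a3p l m) = (-2 : ℤ) • sumFour (fun e a b c => sumFour (fun x p q r =>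
      sumThree (fun _ b c => sumThree (fun _ q r => crSix e x b c q r) p q r) a b c) m) l := by
  have h1 : Dmap F (a3p l m) = sumFour (fun e a b c => sumFour (fun _ p q r =>
      (2 : ℤ) • (
      sumThree (fun _ b c => crSix e b c p q r - crSix e c b p q r) a b c +
      sumThree (fun _ b c => sumThree (fun x y w => crSix e x b c y w) p q r) a b c -
      sumThree (fun _ y w => crSix e a b c y w - crSix e b a c y w + crSix e c a b y w -
        crSix e y a b c w + crSix e w a b c y) p q r)) m) l := by
    simp only [a3p, map_sum, map_zsmul]
    rw [sumFour_eq_sum]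
    refine Finset.sum_congr rfl fun i _ => ?_
    rw [sumFour_eq_sum, Finset.smul_sum]
    refine Finset.sum_congr rfl fun j _ => ?_
    rw [smul_smul, pow_add, Dmap_r3From4_cons]
    exact h.planeGeneric_left i j
  have h2 : sumFour (fun e a b c => sumFour (fun _ p q r =>
      sumThree (fun _ b c => crSix e b c p q r - crSix e c b p q r) a b c) m) l = 0 := by
    rw [sumFour_comm]
    refine (sumFour_congr (g := fun _ _ _ _ => 0) fun j => ?_).trans (by simp [sumFour])
    exact sumFour_pair_eq_zero_of_symm
      (fun e b c => crSix e b c (m (j.succAbove 0)) (m (j.succAbove 1)) (m (j.succAbove 2)))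
      (fun _ _ _ => crSix_comm ..) l
  have h3 : sumFour (fun e a b c => sumFour (fun _ p q r =>
      sumThree (fun _ y w => crSix e a b c y w - crSix e b a c y w + crSix e c a b y w -
        crSix e y a b c w + crSix e w a b c y) p q r) m) l = 0 := by
    refine (sumFour_congr (g := fun _ _ _ _ => 0) fun i => ?_).trans (by simp [sumFour])
    exact sumFour_sumThree_eq_zero _ m
  have h4 : sumFour (fun e a b c => sumFour (fun _ p q r =>
      sumThree (fun _ b c => sumThree (fun x y w => crSix e x b c y w) p q r) a b c) m) l =
      -sumFour (fun e a b c => sumFour (fun x p q r => sumThree (fun _ b c =>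
        sumThree (fun _ q r => crSix e x b c q r) p q r) a b c) m) l := by
    rw [← sumFour_neg]
    refine sumFour_congr fun i => ?_
    have hc (f : Pt F 4 → Pt F 4 → Pt F 4 → Pt F 4 → Pt F 4 → T21 F) (a b c p q r : Pt F 4) :
        sumThree (fun _ b c => sumThree (fun x y w => f b c x y w) p q r) a b c =
        sumThree (fun x y w => sumThree (fun _ b c => f b c x y w) a b c) p q r := by
      simp only [sumThree]; abel
    simp only [fun e x => hc (fun b c _ y w => crSix e x b c y w)]
    simp only [fun e => hc (fun b c x y w => crSix e x b c y w)]
    exact sumFour_sumThree_flip _ m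
  rw [h1]
  simp only [sumFour_zsmul, sumFour_add, sumFour_sub, h2, h3, h4]
  module

lemma sum_perm_three {M : Type} [AddCommGroup M] (g : Fin 3 → Fin 3 → M)
    (hg : ∀ a b, g a b = -g b a) :
    ∑ ρ : Equiv.Perm (Fin 3), (Equiv.Perm.sign ρ : ℤ) • g (ρ 0) (ρ 1) =
      (2 : ℤ) • sumThree (fun _ b c => g b c) 0 1 2 := by
  have h : (Finset.univ : Finset (Equiv.Perm (Fin 3))) =
      {1, Equiv.swap 0 1, Equiv.swap 0 2, Equiv.swap 1 2, Equiv.swap 0 1 * Equiv.swap 1 2,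
        Equiv.swap 1 2 * Equiv.swap 0 1} := by decide
  rw [h, Finset.sum_insert (by decide), Finset.sum_insert (by decide),
    Finset.sum_insert (by decide), Finset.sum_insert (by decide), Finset.sum_insert (by decide),
    Finset.sum_singleton]
  have e1 : (Equiv.swap (1 : Fin 3) 2) 0 = 0 := by decide
  have e2 : (Equiv.swap (0 : Fin 3) 2) 1 = 1 := by decide
  have e3 : (Equiv.swap (0 : Fin 3) 1) 2 = 2 := by decide
  simp [e1, e2, e3, sumThree, hg 1 0, hg 2 0, hg 2 1]
  abel

/-- The contribution of four points to the image of `μ_3` under `δ_3`. -/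
def crMu (e x a b p q : Pt F 4) : T21 F :=
  crB e x a b p q ⊗ₜ ((2 : ℤ) • (fb e x a b + fb e x p q) -
    (fb e x a p + fb e x a q + fb e x b p + fb e x b q))

lemma fs_crLine {e x a b c d : Pt F 4} (hac : br e x a c ≠ 0) (hbd : br e x b d ≠ 0)
    (had : br e x a d ≠ 0) (hbc : br e x b c ≠ 0) :
    fs F (crLine e x a b c d) = fb e x a c + fb e x b d - (fb e x a d + fb e x b c) := by
  rw [crLine_eq, fs_div (mul_ne_zero hac hbd) (mul_ne_zero had hbc), fs_mul hac hbd,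
    fs_mul had hbc]
  rfl

lemma Dmap_gen_sub [Infinite F] {e x a b p q : Pt F 4} (h : LineGeneric e x ![a, b, p, q]) :
    Dmap F (gen (crLine e x a q b p) - gen (crLine e x a p b q)) = crMu e x a b p q := by
  have hab : br e x a b ≠ 0 := h 0 1 (by decide)
  have hap : br e x a p ≠ 0 := h 0 2 (by decide)
  have haq : br e x a q ≠ 0 := h 0 3 (by decide)
  have hbp : br e x b p ≠ 0 := h 1 2 (by decide)
  have hbq : br e x b q ≠ 0 := h 1 3 (by decide)
  have hpb : br e x p b ≠ 0 := h 2 1 (by decide)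
  have hqb : br e x q b ≠ 0 := h 3 1 (by decide)
  have hpq : br e x p q ≠ 0 := h 2 3 (by decide)
  have hqp : br e x q p ≠ 0 := h 3 2 (by decide)
  rw [map_sub, Dmap_gen, Dmap_gen, fs_crLine hab hqp hap hqb, fs_crLine hab hpq haq hpb]
  change crB e x a q b p ⊗ₜ[ℚ] _ - crB e x a p b q ⊗ₜ[ℚ] _ = _
  rw [crB_swap12 e x a b q p hap hbq, crB_swap23, crB_swap12 e x a b p q haq hbp, neg_neg, crMu,
    fb_swap23 e x q p, fb_swap23 e x q b, fb_swap23 e x p b, TensorProduct.neg_tmul,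
    sub_neg_eq_add, ← TensorProduct.tmul_add]
  congr 1
  abel

lemma Dmap_mu3 [Infinite F] {e x : Pt F 4} {a p : Fin 3 → Pt F 4}
    (h : LineGeneric e x (Fin.append a p)) :
    Dmap F (mu3 (crLine e x) a p) = sumThree (fun _ b c => sumThree (fun _ q r =>
      crMu e x b c q r) (p 0) (p 1) (p 2)) (a 0) (a 1) (a 2) := by
  let g (i j k l : Fin 3) : T21 F :=
    Dmap F (gen (crLine e x (a i) (p l) (a j) (p k)) - gen (crLine e x (a i) (p k) (a j) (p l)))
  have g1 (i j k l) : g i j k l = -g i j l k := by simp only [g, ← map_neg, neg_sub]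
  have g2 (i j k l) : g i j k l = -g j i k l := by
    have hc (i j k l) : crLine e x (a i) (p l) (a j) (p k) =
        crLine e x (a j) (p k) (a i) (p l) := by
      rw [crLine_eq, crLine_eq, br_swap23 e x (a i) (a j), br_swap23 e x (p k) (p l),
        br_swap23 e x (a i) (p k), br_swap23 e x (a j) (p l)]
      ring
    simp only [g, ← map_neg, neg_sub]
    rw [hc i j k l, hc i j l k]
  have hf (n k : Fin 3) (hn : n ≠ k) (q r : Fin 3) (hq : q ≠ r) :
      g n k q r = crMu e x (a n) (a k) (p q) (p r) := by
    let f : Fin 4 → Fin 6 := ![Fin.castAdd 3 n, Fin.castAdd 3 k, Fin.natAdd 3 q, Fin.natAdd 3 r]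
    have hf : Function.Injective f := by revert n k q r; decide
    have hz : ![a n, a k, p q, p r] = Fin.append a p ∘ f := by
      ext1 t
      fin_cases t
      · exact (Fin.append_left a p n).symm
      · exact (Fin.append_left a p k).symm
      · exact (Fin.append_right a p q).symm
      · exact (Fin.append_right a p r).symm
    refine Dmap_gen_sub ?_
    rw [hz]
    exact fun s t hst => h _ _ (hf.ne hst)
  have hsum : Dmap F (mu3 (crLine e x) a p) = (1 / 4 : ℚ) • ((2 : ℤ) • sumThree (fun _ i j =>
      (2 : ℤ) • sumThree (fun _ k l => g i j k l) 0 1 2) 0 1 2) := by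
    rw [← sum_perm_three _ fun i j => ?_]
    · simp only [mu3, map_smul, map_sum, map_zsmul]
      refine congrArg ((1 / 4 : ℚ) • ·) (Finset.sum_congr rfl fun σ _ => ?_)
      rw [← sum_perm_three _ fun k l => g1 _ _ k l, Finset.smul_sum]
      refine Finset.sum_congr rfl fun τ _ => ?_
      rw [smul_smul]
    · simp only [sumThree, g2 i j]
      module
  rw [hsum]
  have n01 : (0 : Fin 3) ≠ 1 := by decide
  have n02 : (0 : Fin 3) ≠ 2 := by decide
  have n12 : (1 : Fin 3) ≠ 2 := by decide
  simp only [sumThree, hf _ _ n01 _ _ n01, hf _ _ n01 _ _ n02, hf _ _ n01 _ _ n12,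
    hf _ _ n02 _ _ n01, hf _ _ n02 _ _ n02, hf _ _ n02 _ _ n12,
    hf _ _ n12 _ _ n01, hf _ _ n12 _ _ n02, hf _ _ n12 _ _ n12]
  module

lemma SpaceGeneric.lineGeneric {n k : ℕ} {z : Fin n → Pt F 4} (h : SpaceGeneric z) (i j : Fin n)
    (f : Fin k → Fin n) (hf : Function.Injective f) (hij : i ≠ j) (hi : ∀ s, i ≠ f s)
    (hj : ∀ s, j ≠ f s) : LineGeneric (z i) (z j) (z ∘ f) :=
  fun _ _ hab => h _ _ _ _ hij (hi _) (hi _) (hj _) (hj _) (hf.ne hab)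

lemma Dmap_a3pp [Infinite F] {l m : Fin 4 → Pt F 4} (h : GenericPair l m) :
    Dmap F (a3pp l m) = sumFour (fun e a b c => sumFour (fun x p q r =>
      sumThree (fun _ b c => sumThree (fun _ q r => crMu e x b c q r) p q r) a b c) m) l := by
  simp only [a3pp, map_sum, map_zsmul]
  rw [sumFour_eq_sum]
  refine Finset.sum_congr rfl fun i _ => ?_
  rw [sumFour_eq_sum, Finset.smul_sum]
  refine Finset.sum_congr rfl fun j _ => ?_
  rw [smul_smul, pow_add, Dmap_mu3]
  · rfl
  have hz : Fin.append (l ∘ i.succAbove) (m ∘ j.succAbove) =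
      ![l (i.succAbove 0), l (i.succAbove 1), l (i.succAbove 2), m (j.succAbove 0),
        m (j.succAbove 1), m (j.succAbove 2)] := by
    ext1 k; fin_cases k <;> rfl
  rw [hz, succAbove_vec_eq]
  exact (h.spaceGeneric i j).lineGeneric 0 4 _ (by decide) (by decide) (by decide) (by decide)

lemma sumThree_add {X M : Type} [AddCommGroup M] (f g : X → X → X → M) (x y z : X) :
    sumThree (fun a b c => f a b c + g a b c) x y z = sumThree f x y z + sumThree g x y z := by
  simp only [sumThree]; abel

lemma sumThree_sub {X M : Type} [AddCommGroup M] (f g : X → X → X → M) (x y z : X) :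
    sumThree (fun a b c => f a b c - g a b c) x y z = sumThree f x y z - sumThree g x y z := by
  simp only [sumThree]; abel

lemma sumThree_smul {X M R : Type} [AddCommGroup M] [Ring R] [Module R M] (k : R)
    (f : X → X → X → M) (x y z : X) :
    sumThree (fun a b c => k • f a b c) x y z = k • sumThree f x y z := by
  simp only [sumThree, smul_add, smul_sub]

lemma sumThree_tmul {X M N : Type} [AddCommGroup M] [AddCommGroup N] [Module ℚ M] [Module ℚ N]
    (f : X → X → X → M) (n : N) (x y z : X) :
    sumThree (fun a b c => f a b c ⊗ₜ[ℚ] n) x y z = sumThree f x y z ⊗ₜ[ℚ] n := by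
  simp only [sumThree, TensorProduct.add_tmul, TensorProduct.sub_tmul]

lemma sumFour_smul {X M R : Type} [AddCommGroup M] [Ring R] [Module R M] (k : R)
    (f : X → X → X → X → M) (l : Fin 4 → X) :
    sumFour (fun e a b c => k • f e a b c) l = k • sumFour f l := by
  simp only [sumFour, smul_add, smul_sub]

lemma sumFour_sumThree_comm {X M : Type} [AddCommGroup M]
    (f : X → X → X → X → X → X → X → M) (m : Fin 4 → X) (a b c : X) :
    sumFour (fun x p q r => sumThree (fun t b c => f t b c x p q r) a b c) m =
      sumThree (fun t b c => sumFour (fun x p q r => f t b c x p q r) m) a b c := by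
  simp only [sumFour, sumThree]; abel

lemma sumThree_comm {X M : Type} [AddCommGroup M]
    (f : X → X → X → X → X → X → M) (a b c p q r : X) :
    sumThree (fun a b c => sumThree (fun p q r => f a b c p q r) p q r) a b c =
      sumThree (fun p q r => sumThree (fun a b c => f a b c p q r) a b c) p q r := by
  simp only [sumThree]; abel

/-- The alternating sum of cross-ratios defining `a₂`, in `B_2(F)`. -/
def crAlt (e a b c p q r : Pt F 4) : B2 F :=
  sumThree (fun a b c => sumThree (fun _ q r => crB e a b c q r) p q r) a b c

lemma crAlt_swap [Infinite F] {e a b c p q r : Pt F 4} (h : PlaneGeneric e ![a, b, c, p, q, r]) :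
    sumThree (fun _ b c => sumThree (fun s q r => crB e s b c q r) p q r) a b c =
      -crAlt e a b c p q r := by
  have hl (t : Fin 6) (f : Fin 5 → Fin 6) (hf : Function.Injective f) (ht : ∀ j, t ≠ f j) :=
    crB_five (p := e) (q := ![a, b, c, p, q, r] t) (z := ![a, b, c, p, q, r] ∘ f)
      fun _ _ huv => h _ _ _ (ht _) (ht _) (hf.ne huv)
  have hp (f : Fin 5 → Fin 6) (hf : Function.Injective f) := crB_five_centers (h.comp hf)
  have hl3 : _ = (0 : B2 F) := hl 3 ![0, 1, 2, 4, 5] (by decide) (by decide)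
  have hl4 : _ = (0 : B2 F) := hl 4 ![0, 1, 2, 3, 5] (by decide) (by decide)
  have hl5 : _ = (0 : B2 F) := hl 5 ![0, 1, 2, 3, 4] (by decide) (by decide)
  have hp3 : _ = (0 : B2 F) := hp ![0, 1, 2, 4, 5] (by decide)
  have hp4 : _ = (0 : B2 F) := hp ![0, 1, 2, 3, 5] (by decide)
  have hp5 : _ = (0 : B2 F) := hp ![0, 1, 2, 3, 4] (by decide)
  simp only [Function.comp_apply, Matrix.cons_val] at hl3 hl4 hl5 hp3 hp4 hp5
  simp only [crAlt, sumThree]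
  linear_combination (norm := module) hl3 - hl4 + hl5 + hp3 - hp4 + hp5

lemma Dmap_a3free [Infinite F] {l m : Fin 4 → Pt F 4} (h : GenericPair l m) :
    Dmap F (a3free l m) =
      sumFour (fun _ a b c => sumFour (fun x p q r => crAlt x a b c p q r ⊗ₜ fb x a b c) m) l -
      sumFour (fun e a b c => sumFour (fun _ p q r => crAlt e a b c p q r ⊗ₜ fb e p q r) m) l := by
  have h1 : Dmap F (a3free l m) =
      -(sumFour (fun e a b c => sumFour (fun x p q r => sumThree (fun _ b c =>
        sumThree (fun _ q r => crB e x b c q r ⊗ₜ[ℚ] fb e x b c) p q r) a b c) m) l +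
      sumFour (fun e a b c => sumFour (fun x p q r => sumThree (fun _ b c =>
        sumThree (fun _ q r => crB e x b c q r ⊗ₜ[ℚ] fb e x q r) p q r) a b c) m) l) := by
    have hC (e x a b p q : Pt F 4) : crMu e x a b p q =
        (3 : ℚ) • (crB e x a b p q ⊗ₜ[ℚ] fb e x a b + crB e x a b p q ⊗ₜ[ℚ] fb e x p q) -
        crSix e x a b p q := by
      simp only [crMu, crSix, TensorProduct.tmul_add, TensorProduct.tmul_sub,
        TensorProduct.tmul_smul]
      module
    rw [a3free, map_sub, map_smul, map_smul, Dmap_a3p h, Dmap_a3pp h]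
    simp only [hC, sumThree_add, sumThree_sub, sumThree_smul, sumFour_add, sumFour_sub,
      sumFour_smul]
    module
  have h2 : sumFour (fun e a b c => sumFour (fun x p q r => sumThree (fun _ b c =>
        sumThree (fun _ q r => crB e x b c q r ⊗ₜ[ℚ] fb e x b c) p q r) a b c) m) l =
      -sumFour (fun e a b c => sumFour (fun x p q r =>
        crAlt x a b c p q r ⊗ₜ[ℚ] fb x a b c) m) l := by
    simp only [sumFour_sumThree_comm]
    rw [← neg_eq_iff_eq_neg, ← sumFour_sumThree_flip (fun e _ b c => sumFour (fun x p q r =>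
      sumThree (fun _ q r => crB e x b c q r ⊗ₜ[ℚ] fb e x b c) p q r) m) l]
    simp only [← sumFour_sumThree_comm]
    have hf (x a b c : Pt F 4) : fb a x b c = fb x a b c ∧ fb b x a c = fb x a b c ∧
        fb c x a b = fb x a b c := by
      refine ⟨fb_swap01 .., ?_, ?_⟩
      · rw [fb_swap01, fb_swap12]
      · rw [fb_swap01, fb_swap12, fb_swap23]
    have hx (x a b c p q r : Pt F 4) : sumThree (fun t b c =>
        sumThree (fun _ q r => crB t x b c q r ⊗ₜ[ℚ] fb t x b c) p q r) a b c =
        crAlt x a b c p q r ⊗ₜ[ℚ] fb x a b c := by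
      simp only [sumThree_tmul, crAlt, crB_comm x]
      simp only [sumThree, hf x a b c, TensorProduct.add_tmul, TensorProduct.sub_tmul]
    simp only [hx]
  have h3 : sumFour (fun e a b c => sumFour (fun x p q r => sumThree (fun _ b c =>
        sumThree (fun _ q r => crB e x b c q r ⊗ₜ[ℚ] fb e x q r) p q r) a b c) m) l =
      sumFour (fun e a b c => sumFour (fun x p q r =>
        crAlt e a b c p q r ⊗ₜ[ℚ] fb e p q r) m) l := by
    refine sumFour_congr fun i => ?_
    simp only [sumThree_comm (fun _ b c _ q r => crB _ _ b c q r ⊗ₜ[ℚ] fb _ _ q r)]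
    rw [← neg_inj, ← sumFour_sumThree_flip (fun x _ q r => sumThree (fun _ b c =>
      crB (l i) x b c q r ⊗ₜ[ℚ] fb (l i) x q r) _ _ _) m, ← sumFour_neg]
    refine sumFour_congr fun j => ?_
    have hf (e p q r : Pt F 4) : fb e q p r = fb e p q r ∧ fb e r p q = fb e p q r :=
      ⟨fb_swap12 .., by rw [fb_swap12, fb_swap23]⟩
    have hx (e a b c p q r : Pt F 4) : sumThree (fun s q r =>
        sumThree (fun _ b c => crB e s b c q r ⊗ₜ[ℚ] fb e s q r) a b c) p q r =
        sumThree (fun s q r => sumThree (fun _ b c => crB e s b c q r) a b c) p q r ⊗ₜ[ℚ]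
          fb e p q r := by
      simp only [sumThree_tmul]
      simp only [sumThree, hf e p q r, TensorProduct.add_tmul, TensorProduct.sub_tmul]
    rw [hx, ← TensorProduct.neg_tmul, ← crAlt_swap, sumThree_comm]
    exact h.planeGeneric_left i j
  rw [h1, h2, h3]
  abel

lemma tupleOf_eq {X : Type} (S : Finset (Fin 4)) (x : Fin 4 → X) {c : ℕ} (t : Fin c) :
    tupleOf S x t = x (((List.finRange 4).filter (· ∈ S)).getD t 0) := by
  rw [tupleOf]
  congr 2
  have h : ((List.finRange 4).filter (· ∈ S)).toFinset = S := by ext; simp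
  conv_lhs => rw [← h]
  rw [List.toFinset_sort _ ((List.nodup_finRange 4).filter _)]
  exact List.Pairwise.filter _ (List.pairwise_le_finRange 4)

section subsets
variable {M : Type} [AddCommGroup M]

lemma sum_ite_card_one (f : Finset (Fin 4) → M) :
    (∑ I : Finset (Fin 4), if (0 : Fin 4) ∉ I ∧ I.card = 1 then f I else 0) =
      ∑ i : Fin 3, f {i.succ} := by
  rw [← Finset.sum_filter, show Finset.univ.filter (fun I : Finset (Fin 4) => 0 ∉ I ∧ I.card = 1) =
    Finset.univ.image fun i : Fin 3 => {i.succ} by decide, Finset.sum_image]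
  exact Function.Injective.injOn (by decide)

lemma sum_ite_card_two (f : Finset (Fin 4) → M) :
    (∑ I : Finset (Fin 4), if (0 : Fin 4) ∉ I ∧ I.card = 2 then f I else 0) =
      ∑ i : Fin 3, f {0, i.succ}ᶜ := by
  rw [← Finset.sum_filter, show Finset.univ.filter (fun I : Finset (Fin 4) => 0 ∉ I ∧ I.card = 2) =
    Finset.univ.image fun i : Fin 3 => {0, i.succ}ᶜ by decide, Finset.sum_image]
  exact Function.Injective.injOn (by decide)

lemma sum_ite_and (a b : ℕ) (f : Finset (Fin 4) → Finset (Fin 4) → M) :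
    (∑ I : Finset (Fin 4), ∑ J : Finset (Fin 4),
      if (0 : Fin 4) ∉ I ∧ I.card = a ∧ (0 : Fin 4) ∉ J ∧ J.card = b then f I J else 0) =
    ∑ I : Finset (Fin 4), if (0 : Fin 4) ∉ I ∧ I.card = a then
      ∑ J : Finset (Fin 4), if (0 : Fin 4) ∉ J ∧ J.card = b then f I J else 0 else 0 := by
  refine Finset.sum_congr rfl fun I _ => ?_
  by_cases h : (0 : Fin 4) ∉ I ∧ I.card = a
  · simp [h]
  · rw [if_neg h]
    exact Finset.sum_eq_zero fun J _ => if_neg fun h' => h ⟨h'.1, h'.2.1⟩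

end subsets

lemma tupleOf_singleton {X : Type} (x : Fin 4 → X) (i : Fin 3) :
    tupleOf {i.succ} x (c := 1) 0 = x i.succ := by
  rw [tupleOf_eq]; congr 1; revert i; decide

lemma tupleOf_compl_singleton {X : Type} (x : Fin 4 → X) (i : Fin 3) :
    tupleOf {i.succ}ᶜ x (c := 3) = x ∘ i.succ.succAbove := by
  ext1 t; rw [tupleOf_eq]; refine congrArg x ?_; revert i t; decide

lemma tupleOf_insert_zero {X : Type} (x : Fin 4 → X) (i : Fin 3) :
    tupleOf (insert 0 {0, i.succ}ᶜ) x (c := 3) = x ∘ i.succ.succAbove := by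
  ext1 t; rw [tupleOf_eq]; refine congrArg x ?_; revert i t; decide

lemma tupleOf_pair_zero {X : Type} (x : Fin 4 → X) (i : Fin 3) :
    tupleOf {0, i.succ}ᶜ x (c := 2) 0 = x (i.succ.succAbove 1) := by
  rw [tupleOf_eq]; congr 1; revert i; decide

lemma tupleOf_pair_one {X : Type} (x : Fin 4 → X) (i : Fin 3) :
    tupleOf {0, i.succ}ᶜ x (c := 2) 1 = x (i.succ.succAbove 2) := by
  rw [tupleOf_eq]; congr 1; revert i; decide

lemma tupleOf_compl_pair_one {X : Type} (x : Fin 4 → X) (i : Fin 3) :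
    tupleOf ({0, i.succ}ᶜ)ᶜ x (c := 2) 1 = x i.succ := by
  rw [tupleOf_eq]; congr 1; revert i; decide

lemma shufSign_mul (i k : Fin 3) :
    shufSign {i.succ} * shufSign {0, k.succ}ᶜ = (-1) ^ (i : ℕ) * (-1) ^ (k : ℕ) := by
  revert i k; simp only [shufSign]; decide

lemma sum_tmul_cross {M N : Type} [AddCommGroup M] [AddCommGroup N] [Module ℚ M] [Module ℚ N]
    (α : Fin 4 → Fin 4 → M) (β : Fin 4 → Fin 4 → N)
    (hl : ∀ k, ∑ i : Fin 4, ((-1 : ℤ) ^ (i : ℕ)) • α i k = 0)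
    (hr : ∀ i, ∑ k : Fin 4, ((-1 : ℤ) ^ (k : ℕ)) • α i k = 0) :
    ∑ i : Fin 3, ∑ k : Fin 3, ((-1 : ℤ) ^ (i : ℕ) * (-1) ^ (k : ℕ)) •
      (α i.succ k.succ ⊗ₜ[ℚ] (β 0 k.succ + β i.succ 0 - (β 0 0 + β i.succ k.succ))) =
    -∑ i : Fin 4, ((-1 : ℤ) ^ (i : ℕ)) • ∑ k : Fin 4, ((-1 : ℤ) ^ (k : ℕ)) •
      (α i k ⊗ₜ[ℚ] β i k) := by
  have hl' (k) : α 0 k = α 1 k - α 2 k + α 3 k := by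
    have := hl k
    simp [Fin.sum_univ_four, pow_succ] at this
    linear_combination (norm := module) this
  have hr' (i) : α i 0 = α i 1 - α i 2 + α i 3 := by
    have := hr i
    simp [Fin.sum_univ_four, pow_succ] at this
    linear_combination (norm := module) this
  simp [Fin.sum_univ_four, Fin.sum_univ_three, hr', hl' 1, hl' 2, hl' 3, pow_succ,
    TensorProduct.tmul_add, TensorProduct.tmul_sub, TensorProduct.add_tmul,
    TensorProduct.sub_tmul]
  abel

lemma castAdd_ne_natAdd {n k : ℕ} (i : Fin n) (j : Fin k) : Fin.castAdd k i ≠ Fin.natAdd n j :=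
  fun h => (i.2.trans_le (Nat.le_add_right n j)).ne (congrArg Fin.val h)

lemma GenericPair.br_left_ne {l m : Fin 4 → Pt F 4} (h : GenericPair l m) {i j k : Fin 4}
    (hij : i ≠ j) (hik : i ≠ k) (hjk : j ≠ k) (t : Fin 4) : br (l i) (l j) (l k) (m t) ≠ 0 := by
  have hl := Fin.castAdd_injective 4 4
  have := h _ _ _ (Fin.natAdd 4 t) (hl.ne hij) (hl.ne hik) (castAdd_ne_natAdd i t) (hl.ne hjk)
    (castAdd_ne_natAdd j t) (castAdd_ne_natAdd k t)
  rwa [Fin.append_left, Fin.append_left, Fin.append_left, Fin.append_right] at this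

lemma GenericPair.br_right_ne {l m : Fin 4 → Pt F 4} (h : GenericPair l m) {i j k : Fin 4}
    (hij : i ≠ j) (hik : i ≠ k) (hjk : j ≠ k) (t : Fin 4) : br (m i) (m j) (l t) (m k) ≠ 0 := by
  have hm := Fin.natAdd_injective 4 4
  have := h _ _ (Fin.castAdd 4 t) _ (hm.ne hij) (castAdd_ne_natAdd t i).symm (hm.ne hik)
    (castAdd_ne_natAdd t j).symm (hm.ne hjk) (castAdd_ne_natAdd t k)
  rwa [Fin.append_right, Fin.append_right, Fin.append_left, Fin.append_right] at this

lemma clsB2_a2From4 (e : Pt F 4) (x y : Fin 3 → Pt F 4) :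
    clsB2 F (a2From4 e x y) = crAlt e (x 0) (x 1) (x 2) (y 0) (y 1) (y 2) := by
  have h1 (i j : Fin 3) : clsB2 F (gen (crLine e (x i) (x (i.succAbove 0)) (x (i.succAbove 1))
      (y (j.succAbove 0)) (y (j.succAbove 1)))) = crB e (x i) (x (i.succAbove 0))
      (x (i.succAbove 1)) (y (j.succAbove 0)) (y (j.succAbove 1)) := rfl
  have e0 : (0 : Fin 3).succAbove 0 = 1 ∧ (0 : Fin 3).succAbove 1 = 2 := by decide
  have e1 : (1 : Fin 3).succAbove 0 = 0 ∧ (1 : Fin 3).succAbove 1 = 2 := by decide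
  have e2 : (2 : Fin 3).succAbove 0 = 0 ∧ (2 : Fin 3).succAbove 1 = 1 := by decide
  rw [a2From4, map_sum]
  simp only [map_sum, map_zsmul, h1]
  simp [Fin.sum_univ_three, e0, e1, e2, crAlt, sumThree, pow_succ]
  abel

lemma sumFour_crAlt_left (l : Fin 4 → Pt F 4) (p q r : Pt F 4) :
    sumFour (fun e a b c => crAlt e a b c p q r) l = 0 :=
  sumFour_sumThree_eq_zero_of_symm (fun e a b c => sumThree (fun _ q r => crB e a b c q r) p q r)
    (fun x y _ _ => by simp only [crB_comm x y]) l

lemma sumFour_crAlt_right (e a b c : Pt F 4) (m : Fin 4 → Pt F 4) :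
    sumFour (fun _ p q r => crAlt e a b c p q r) m = 0 := by
  simp only [crAlt, sumThree_comm (fun a b c _ q r => crB e a b c q r)]
  exact sumFour_sumThree_eq_zero _ m

lemma fb_swap_pairs (a b c d : Pt F 4) : fb a b c d = fb c a d b := by
  rw [fb_swap01 a c d b, fb_swap23 a c b d, fb_swap12 a b c d]

lemma fb_insert_succAbove (e : Pt F 4) (z : Fin 3 → Pt F 4) (k : Fin 3) :
    fb e (z k) (z (k.succAbove 0)) (z (k.succAbove 1)) = fb e (z 0) (z 1) (z 2) := by
  fin_cases k
  · rfl
  · exact fb_swap12 ..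
  · exact (fb_swap12 ..).trans (fb_swap23 ..)

lemma sum_two_one [Infinite F] {l m : Fin 4 → Pt F 4} (h : GenericPair l m) :
    (∑ I : Finset (Fin 4), ∑ J : Finset (Fin 4),
      if (0 : Fin 4) ∉ I ∧ I.card = 1 ∧ (0 : Fin 4) ∉ J ∧ J.card = 2 then
        (shufSign I * shufSign J) •
          (clsB2 F (a2From4 (tupleOf I l (c := 1) 0) (tupleOf Iᶜ l) (tupleOf (insert 0 J) m))
            ⊗ₜ[ℚ]
            fs F (crLine (tupleOf J m (c := 2) 0) (tupleOf J m (c := 2) 1)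
              (l 0) (tupleOf I l (c := 1) 0) (m 0) (tupleOf Jᶜ m (c := 2) 1)))
      else 0) =
    -sumFour (fun e a b c => sumFour (fun _ p q r => crAlt e a b c p q r ⊗ₜ fb e p q r) m) l := by
  let α (i k : Fin 4) : B2 F := crAlt (l i) (l (i.succAbove 0)) (l (i.succAbove 1))
    (l (i.succAbove 2)) (m (k.succAbove 0)) (m (k.succAbove 1)) (m (k.succAbove 2))
  let β (i k : Fin 4) : FS F :=
    fb (l i) (m (k.succAbove 0)) (m (k.succAbove 1)) (m (k.succAbove 2))
  rw [sum_ite_and]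
  simp only [sum_ite_card_two, sum_ite_card_one, tupleOf_singleton, tupleOf_compl_singleton,
    tupleOf_insert_zero, tupleOf_pair_zero, tupleOf_pair_one, tupleOf_compl_pair_one, shufSign_mul,
    clsB2_a2From4]
  refine Eq.trans ?_ ((sum_tmul_cross α β (fun k => ?_) fun i => ?_).trans ?_)
  · refine Finset.sum_congr rfl fun i _ => Finset.sum_congr rfl fun k _ => ?_
    have hk : k.succ.succAbove 1 ≠ 0 ∧ k.succ.succAbove 2 ≠ 0 ∧
        k.succ.succAbove 1 ≠ k.succ.succAbove 2 := by revert k; decide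
    have hk' := (Fin.succAbove_ne k.succ)
    rw [fs_crLine (h.br_right_ne hk.2.2 hk.1 hk.2.1 _) (h.br_right_ne hk.2.2 (hk' 1) (hk' 2) _)
      (h.br_right_ne hk.2.2 (hk' 1) (hk' 2) _) (h.br_right_ne hk.2.2 hk.1 hk.2.1 _)]
    have hf (t) : fb (m (k.succ.succAbove 1)) (m (k.succ.succAbove 2)) (l t) (m 0) =
        β t k.succ := by
      rw [fb_swap_pairs, fb_swap12]; rfl
    have hf' (t) : fb (m (k.succ.succAbove 1)) (m (k.succ.succAbove 2)) (l t) (m k.succ) =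
        β t 0 := by
      rw [fb_swap_pairs, fb_swap12, show k.succ.succAbove 1 = (k.succAbove 0).succ from
        Fin.succ_succAbove_succ k 0, show k.succ.succAbove 2 = (k.succAbove 1).succ from
        Fin.succ_succAbove_succ k 1]
      exact fb_insert_succAbove (l t) (m ∘ Fin.succ) k
    simp only [hf, hf']
    rfl
  · exact (sumFour_eq_sum (fun e a b c => crAlt e a b c _ _ _) l).symm.trans
      (sumFour_crAlt_left ..)
  · exact (sumFour_eq_sum (fun _ p q r => crAlt _ _ _ _ p q r) m).symm.trans
      (sumFour_crAlt_right ..)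
  · rw [sumFour_eq_sum]
    simp only [sumFour_eq_sum]
    rfl

lemma sum_one_two [Infinite F] {l m : Fin 4 → Pt F 4} (h : GenericPair l m) :
    (∑ I : Finset (Fin 4), ∑ J : Finset (Fin 4),
      if (0 : Fin 4) ∉ I ∧ I.card = 2 ∧ (0 : Fin 4) ∉ J ∧ J.card = 1 then
        (shufSign I * shufSign J) •
          (clsB2 F (a2From4 (tupleOf J m (c := 1) 0) (tupleOf (insert 0 I) l) (tupleOf Jᶜ m))
            ⊗ₜ[ℚ]
            fs F (crLine (tupleOf I l (c := 2) 0) (tupleOf I l (c := 2) 1)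
              (l 0) (tupleOf Iᶜ l (c := 2) 1) (m 0) (tupleOf J m (c := 1) 0)))
      else 0) =
    -sumFour (fun _ a b c => sumFour (fun x p q r => crAlt x a b c p q r ⊗ₜ fb x a b c) m) l := by
  let α (i k : Fin 4) : B2 F := crAlt (m k) (l (i.succAbove 0)) (l (i.succAbove 1))
    (l (i.succAbove 2)) (m (k.succAbove 0)) (m (k.succAbove 1)) (m (k.succAbove 2))
  let β (i k : Fin 4) : FS F :=
    fb (m k) (l (i.succAbove 0)) (l (i.succAbove 1)) (l (i.succAbove 2))
  have hs (i k : Fin 4) : α i k = -sumThree (fun _ b c => sumThree (fun s q r =>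
      crB (m k) s b c q r) (m (k.succAbove 0)) (m (k.succAbove 1)) (m (k.succAbove 2)))
      (l (i.succAbove 0)) (l (i.succAbove 1)) (l (i.succAbove 2)) := by
    rw [crAlt_swap, neg_neg]
    exact h.planeGeneric_right i k
  rw [sum_ite_and]
  simp only [sum_ite_card_two, sum_ite_card_one, tupleOf_singleton, tupleOf_compl_singleton,
    tupleOf_insert_zero, tupleOf_pair_zero, tupleOf_pair_one, tupleOf_compl_pair_one,
    mul_comm (shufSign _ᶜ), shufSign_mul, clsB2_a2From4]
  refine Eq.trans ?_ ((sum_tmul_cross α β (fun k => ?_) fun i => ?_).trans ?_)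
  · refine Finset.sum_congr rfl fun i _ => Finset.sum_congr rfl fun k _ => ?_
    have hi : i.succ.succAbove 1 ≠ 0 ∧ i.succ.succAbove 2 ≠ 0 ∧
        i.succ.succAbove 1 ≠ i.succ.succAbove 2 := by revert i; decide
    have hi' := Fin.succAbove_ne i.succ
    rw [fs_crLine (h.br_left_ne hi.2.2 hi.1 hi.2.1 _) (h.br_left_ne hi.2.2 (hi' 1) (hi' 2) _)
      (h.br_left_ne hi.2.2 hi.1 hi.2.1 _) (h.br_left_ne hi.2.2 (hi' 1) (hi' 2) _)]
    have hf (t) : fb (l (i.succ.succAbove 1)) (l (i.succ.succAbove 2)) (l 0) (m t) =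
        β i.succ t := by
      rw [fb_swap23, fb_swap_pairs, fb_swap12]; rfl
    have hf' (t) : fb (l (i.succ.succAbove 1)) (l (i.succ.succAbove 2)) (l i.succ) (m t) =
        β 0 t := by
      rw [fb_swap23, fb_swap_pairs, fb_swap12, show i.succ.succAbove 1 = (i.succAbove 0).succ from
        Fin.succ_succAbove_succ i 0, show i.succ.succAbove 2 = (i.succAbove 1).succ from
        Fin.succ_succAbove_succ i 1]
      exact fb_insert_succAbove (m t) (l ∘ Fin.succ) i
    simp only [hf, hf', mul_comm ((-1 : ℤ) ^ (k : ℕ))]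
    rw [add_comm (β i.succ 0), add_comm (β i.succ k.succ)]
    rfl
  · refine (sumFour_eq_sum (fun _ a b c => crAlt _ a b c _ _ _) l).symm.trans ?_
    rw [sumFour_congr (g := fun _ a b c => -sumThree (fun _ b c => sumThree (fun s q r =>
      crB (m k) s b c q r) (m (k.succAbove 0)) (m (k.succAbove 1)) (m (k.succAbove 2))) a b c)
      (hs · k), sumFour_neg, neg_eq_zero]
    exact sumFour_sumThree_eq_zero _ l
  · refine (sumFour_eq_sum (fun e p q r => crAlt e _ _ _ p q r) m).symm.trans ?_
    rw [sumFour_congr (g := fun e p q r => -sumThree (fun _ b c => sumThree (fun s q r =>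
      crB e s b c q r) p q r) (l (i.succAbove 0)) (l (i.succAbove 1)) (l (i.succAbove 2))) (hs i),
      sumFour_neg, neg_eq_zero]
    simp only [sumThree_comm (fun _ b c s q r => crB _ s b c q r)]
    exact sumFour_sumThree_eq_zero_of_symm (fun e s q r => sumThree (fun _ b c => crB e s b c q r)
      (l (i.succAbove 0)) (l (i.succAbove 1)) (l (i.succAbove 2)))
      (fun x y _ _ => by simp only [crB_comm x y]) m
  · rw [sumFour_eq_sum]
    simp only [sumFour_eq_sum]
    rfl

lemma Dmap_eq_zero_of_finite [Finite F] (z : QF F) : Dmap F z = 0 := by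
  simp [Dmap, Finsupp.lift_apply, fs_eq_zero_of_finite]

/-- Theorem 3.2.  For every admissible pair of tetrahedra
`(l_0,...,l_3;m_0,...,m_3)` in generic position in `P³(F)`,
`δ_3(a_3(l;m)) = (a_2 ∧ a_1)(ν_{2,1}(l;m) + ν_{1,2}(l;m))` in `(B_2(F) ⊗ F^*) ⊗ ℚ`,
where `a_3 = (1/6)a_3' - (1/3)a_3''`, `(a_2 ∧ a_1)(x_2 ⊗ x_1 + y_1 ⊗ y_2) =
a_2(x_2) ⊗ a_1(x_1) - a_2(y_2) ⊗ a_1(y_1)`, and `ν_{2,1}`, `ν_{1,2}` are given on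
generators by the defining `(I,J)`-sums (applied here at the level of configurations,
with `a_2`, `a_1` evaluated on each resulting generator). -/
theorem statement5 (F : Type) [Field F] (l m : Fin 4 → Pt F 4) (h : GenericPair l m) :
    Dmap F (a3free l m) =
      (∑ I : Finset (Fin 4), ∑ J : Finset (Fin 4),
        if (0 : Fin 4) ∉ I ∧ I.card = 1 ∧ (0 : Fin 4) ∉ J ∧ J.card = 2 then
          (shufSign I * shufSign J) •
            (clsB2 F (a2From4 (tupleOf I l (c := 1) 0) (tupleOf Iᶜ l) (tupleOf (insert 0 J) m))
              ⊗ₜ[ℚ]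
              fs F (crLine (tupleOf J m (c := 2) 0) (tupleOf J m (c := 2) 1)
                (l 0) (tupleOf I l (c := 1) 0) (m 0) (tupleOf Jᶜ m (c := 2) 1)))
        else 0) -
      (∑ I : Finset (Fin 4), ∑ J : Finset (Fin 4),
        if (0 : Fin 4) ∉ I ∧ I.card = 2 ∧ (0 : Fin 4) ∉ J ∧ J.card = 1 then
          (shufSign I * shufSign J) •
            (clsB2 F (a2From4 (tupleOf J m (c := 1) 0) (tupleOf (insert 0 I) l) (tupleOf Jᶜ m))
              ⊗ₜ[ℚ]
              fs F (crLine (tupleOf I l (c := 2) 0) (tupleOf I l (c := 2) 1)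
                (l 0) (tupleOf Iᶜ l (c := 2) 1) (m 0) (tupleOf J m (c := 1) 0)))
        else 0) := by
  rcases finite_or_infinite F with hF | hF
  · simp only [Dmap_eq_zero_of_finite, fs_eq_zero_of_finite, TensorProduct.tmul_zero, smul_zero,
      ite_self, Finset.sum_const_zero, sub_zero]
  · rw [Dmap_a3free h, sum_two_one h, sum_one_two h]
    abel

end Gon
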